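/- arXiv:1705.08714 — 5 statements merged into one kernel-verified Lean document; each statement's English description precedes it below -/
import Mathlib

section
/- Let δ : ℝ≥1 → ℝ>0 be any decreasing function such that |M(t)| ≤ t·δ(t) for all t ≥ 1, where M is the Mertens function. Then for every ε > 0 there is a constant K > 0 such that for all integers T ≥ 3, |C(T) − F(T)·G(T)| ≤ K·(T^{11/4+ε} + T³·δ(T^{1/2})·log T). -/
/-- The set of Farey fractions of order `T`: rationals `a/b` with
`0 ≤ a < b ≤ T` and `gcd(a,b) = 1`, viewed as a finite set of rationals in `[0,1)`. -/
def farey (T : ℕ) : Finset ℚ :=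
  (((Finset.range (T + 1)) ×ˢ (Finset.range (T + 1))).filter
    (fun p => p.1 < p.2 ∧ Nat.gcd p.1 p.2 = 1)).image (fun p => (p.1 : ℚ) / (p.2 : ℚ))

/-- `F(T)` is the number of Farey fractions of order `T`. -/
def F (T : ℕ) : ℕ := (farey T).card

/-- The Farey fractions of order `T` lying in `[0, 1/2]`. -/
def fareyHalf (T : ℕ) : Finset ℚ := (farey T).filter (fun q => q ≤ 1 / 2)

/-- `C(T) = ∑_{a/b ∈ 𝓕(T) ∩ [0,1/2]} #(𝓕(T) ∩ [1 - a²/b², 1])`, where a Farey fraction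
`q = a/b` in lowest terms satisfies `a²/b² = q²`. -/
def C (T : ℕ) : ℕ :=
  ∑ q ∈ fareyHalf T, ((farey T).filter (fun ξ => 1 - q ^ 2 ≤ ξ ∧ ξ ≤ 1)).card

/-- `G(T) = ∑_{ξ ∈ 𝓕(T), ξ ≤ 1/2} ξ²`. -/
noncomputable def G (T : ℕ) : ℝ := ∑ q ∈ fareyHalf T, (q : ℝ) ^ 2

/-- The Mertens function `M(n) = ∑_{1 ≤ k ≤ n} μ(k)`. -/
def mertens (n : ℕ) : ℤ := ∑ k ∈ Finset.Icc 1 n, ArithmeticFunction.moebius k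


/-- The sawtooth function. -/
noncomputable def sawt (y : ℝ) : ℝ := Int.fract y - 1 / 2

lemma sawt_abs_le (y : ℝ) : |sawt y| ≤ 1 / 2 := by
  unfold sawt
  have h1 := Int.fract_nonneg y
  have h2 := (Int.fract_lt_one y).le
  rw [abs_le]; constructor <;> linarith

lemma fract_near (q ρ : ℕ) (hρ : ρ < q) (y : ℝ) (h1 : (ρ : ℝ) - 2 ≤ q * y)
    (h2 : q * y ≤ ρ + 3) :
    |Int.fract y - ρ / q| ≤ 3 / q + if (ρ < 2 ∨ q ≤ ρ + 3) then 1 else 0 := by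
  have hq : (0 : ℝ) < q := by exact_mod_cast (by omega : 0 < q)
  have hρ' : (ρ : ℝ) < q := by exact_mod_cast hρ
  split_ifs with h
  · have a1 := Int.fract_nonneg y
    have a2 := (Int.fract_lt_one y).le
    have a3 : (0 : ℝ) ≤ ρ / q := by positivity
    have a4 : (ρ : ℝ) / q ≤ 1 := by rw [div_le_one hq]; exact hρ'.le
    have a5 : (0 : ℝ) ≤ 3 / q := by positivity
    rw [abs_le]; constructor <;> linarith
  · push Not at h
    have b1 : (2 : ℝ) ≤ ρ := by exact_mod_cast h.1
    have b2 : (ρ : ℝ) + 3 < q := by exact_mod_cast h.2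
    have hy0 : 0 ≤ y := by
      by_contra hc
      push Not at hc
      nlinarith
    have hy1 : y < 1 := by
      by_contra hc
      push Not at hc
      nlinarith
    rw [Int.fract_eq_self.2 ⟨hy0, hy1⟩, add_zero]
    have : y - ρ / q = (q * y - ρ) / q := by field_simp
    rw [this, abs_div, abs_of_pos hq]
    apply div_le_div_of_nonneg_right _ hq.le
    rw [abs_le]; constructor <;> linarith

lemma card_bad (q : ℕ) :
    ∑ ρ ∈ Finset.range q, (if (ρ < 2 ∨ q ≤ ρ + 3) then (1 : ℝ) else 0) ≤ 5 := by
  rw [Finset.sum_ite]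
  simp only [Finset.sum_const_zero, add_zero, Finset.sum_const, nsmul_eq_mul, mul_one]
  have : (Finset.range q).filter (fun ρ => ρ < 2 ∨ q ≤ ρ + 3) ⊆
      Finset.range 2 ∪ Finset.Ico (q - 3) q := by
    intro ρ
    simp only [Finset.mem_filter, Finset.mem_range, Finset.mem_union, Finset.mem_Ico]
    omega
  have h2 := (Finset.card_le_card this).trans (Finset.card_union_le _ _)
  simp only [Finset.card_range, Nat.card_Ico] at h2
  have : ((Finset.range q).filter (fun ρ => ρ < 2 ∨ q ≤ ρ + 3)).card ≤ 5 := by omega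
  exact_mod_cast this

lemma sum_perm (q : ℕ) (hq : 0 < q) (p u : ℤ) (hpq : IsCoprime p (q : ℤ)) (g : ℕ → ℝ) :
    ∑ j ∈ Finset.range q, g (((u + p * j) % q).toNat) = ∑ j ∈ Finset.range q, g j := by
  have hq' : (0 : ℤ) < q := by exact_mod_cast hq
  have hinj : Set.InjOn (fun j : ℕ => ((u + p * j) % q).toNat) (Finset.range q : Set ℕ) := by
    intro i hi j hj hij
    simp only [Finset.coe_range, Set.mem_Iio] at hi hj
    have e1 := Int.emod_nonneg (u + p * i) hq'.ne'
    have e2 := Int.emod_nonneg (u + p * j) hq'.ne'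
    simp only at hij
    have e3 : (u + p * i) % q = (u + p * j) % q := by omega
    have e4 : (q : ℤ) ∣ (u + p * j) - (u + p * i) := (Int.ModEq.dvd e3)
    have e5 : (q : ℤ) ∣ p * (j - i) := by convert e4 using 1; ring
    have e6 : (q : ℤ) ∣ (j - i : ℤ) := hpq.symm.dvd_of_dvd_mul_left e5
    have e7 := Int.eq_zero_of_abs_lt_dvd e6 (by rw [abs_lt]; omega)
    omega
  have himg : (Finset.range q).image (fun j : ℕ => ((u + p * j) % q).toNat) = Finset.range q := by
    apply Finset.eq_of_subset_of_card_le
    · intro x hx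
      obtain ⟨j, hj, rfl⟩ := Finset.mem_image.1 hx
      have e1 := Int.emod_nonneg (u + p * j) hq'.ne'
      have e2 := Int.emod_lt_of_pos (u + p * j) hq'
      simp only [Finset.mem_range]
      omega
    · rw [Finset.card_image_of_injOn hinj]
  conv_rhs => rw [← himg]
  rw [Finset.sum_image hinj]

lemma block_bound (x β α : ℝ) (r : ℚ) (h : |β - r| ≤ 1 / (r.den : ℝ) ^ 2) (hα : 0 ≤ α)
    (hα3 : α * (r.den : ℝ) ^ 3 ≤ 1) :
    |∑ j ∈ Finset.range r.den, sawt (x + β * j + α * (j : ℝ) ^ 2)| ≤ 10 := by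
  set q := r.den with hqdef
  have hq : 0 < q := r.den_pos
  have hqR : (0 : ℝ) < q := by exact_mod_cast hq
  have hqZ : (0 : ℤ) < q := by exact_mod_cast hq
  set p := r.num with hp
  set u := ⌊x * q⌋ with hu
  have hr : (r : ℝ) = p / q := by
    rw [hp, hqdef]; exact_mod_cast (Rat.num_div_den r).symm
  have hcop : IsCoprime p (q : ℤ) := by
    rw [Int.isCoprime_iff_gcd_eq_one]
    exact r.reduced
  have key : ∀ j ∈ Finset.range q,
      |Int.fract (x + β * j + α * (j : ℝ) ^ 2) - (((u + p * j) % q).toNat : ℕ) / (q : ℝ)| ≤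
      3 / q + if ((((u + p * j) % q).toNat) < 2 ∨ q ≤ (((u + p * j) % q).toNat) + 3)
        then 1 else 0 := by
    intro j hj
    have hj' : (j : ℝ) < q := by exact_mod_cast (Finset.mem_range.1 hj)
    have hj0 : (0 : ℝ) ≤ j := by positivity
    set ρ := ((u + p * j) % q).toNat with hρ
    set m := (u + p * j) / q with hm
    have e1 := Int.emod_nonneg (u + p * j) hqZ.ne'
    have e2 := Int.emod_lt_of_pos (u + p * j) hqZ
    have e3 : (q : ℤ) * m + ρ = u + p * j := by
      have := Int.mul_ediv_add_emod (u + p * j) q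
      rw [hρ, Int.toNat_of_nonneg e1]; exact this
    have e3' : (q : ℝ) * m + ρ = u + p * j := by exact_mod_cast e3
    have e4 : Int.fract (x + β * j + α * (j : ℝ) ^ 2) =
        Int.fract (x + β * j + α * (j : ℝ) ^ 2 - m) := (Int.fract_sub_intCast _ _).symm
    rw [e4]
    have v1 := Int.floor_le (x * q)
    have v2 := Int.lt_floor_add_one (x * q)
    rw [← hu] at v1 v2
    have e5 : (q : ℝ) * (x + β * j + α * (j : ℝ) ^ 2 - m) =
        ρ + (x * q - u) + q * (β - r) * j + α * q * (j : ℝ) ^ 2 := by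
      rw [hr]; field_simp; linarith
    have w1 : |q * (β - r) * j| ≤ 1 := by
      rw [abs_mul, abs_mul, abs_of_pos hqR, abs_of_nonneg hj0]
      calc (q : ℝ) * |β - r| * j ≤ q * (1 / (q : ℝ) ^ 2) * q := by gcongr
        _ = 1 := by field_simp
    have w2 : α * q * (j : ℝ) ^ 2 ≤ 1 := by
      calc α * q * (j : ℝ) ^ 2 ≤ α * q * (q : ℝ) ^ 2 := by gcongr
        _ = α * (q : ℝ) ^ 3 := by ring
        _ ≤ 1 := hα3
    have w3 : 0 ≤ α * q * (j : ℝ) ^ 2 := by positivity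
    rw [abs_le] at w1
    apply fract_near q ρ (by omega)
    · rw [e5]; linarith
    · rw [e5]; linarith
  have s1 : ∑ j ∈ Finset.range q, sawt (x + β * j + α * (j : ℝ) ^ 2) =
      ∑ j ∈ Finset.range q, (Int.fract (x + β * j + α * (j : ℝ) ^ 2) -
        (((u + p * j) % q).toNat : ℕ) / (q : ℝ)) - 1 / 2 := by
    have := sum_perm q hq p u hcop (fun ρ => (ρ : ℝ) / q)
    unfold sawt
    rw [Finset.sum_sub_distrib, Finset.sum_sub_distrib, this]
    have hdv : ∑ ρ ∈ Finset.range q, (ρ : ℝ) / q = (∑ ρ ∈ Finset.range q, (ρ : ℝ)) / q :=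
      (Finset.sum_div _ _ _).symm
    rw [hdv]
    have g := Finset.sum_range_id_mul_two q
    have g2 : (∑ i ∈ Finset.range q, (i : ℝ)) * 2 = q * (q - 1) := by
      have h1 : ((q - 1 : ℕ) : ℝ) = q - 1 := by
        rw [Nat.cast_sub hq]; simp
      rw [← h1]
      have g' := congrArg (Nat.cast : ℕ → ℝ) g
      rw [Nat.cast_mul, Nat.cast_mul, Nat.cast_sum] at g'
      exact_mod_cast g'
    have g3 : ∑ i ∈ Finset.range q, (i : ℝ) = q * (q - 1) / 2 := by linarith
    rw [g3]
    generalize ∑ j ∈ Finset.range q, Int.fract (x + β * j + α * (j : ℝ) ^ 2) = Z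
    simp
    field_simp
    ring
  have s2 : |∑ j ∈ Finset.range q, (Int.fract (x + β * j + α * (j : ℝ) ^ 2) -
        (((u + p * j) % q).toNat : ℕ) / (q : ℝ))| ≤ 8 := by
    refine (Finset.abs_sum_le_sum_abs _ _).trans ((Finset.sum_le_sum key).trans ?_)
    rw [Finset.sum_add_distrib]
    have := sum_perm q hq p u hcop (fun ρ => if (ρ < 2 ∨ q ≤ ρ + 3) then (1 : ℝ) else 0)
    rw [this]
    have := card_bad q
    have h3 : ∑ j ∈ Finset.range q, (3 : ℝ) / q = 3 := by
      simp; field_simp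
    linarith
  rw [s1]
  rw [abs_le] at s2 ⊢
  constructor <;> linarith [s2.1, s2.2]

/-- antiderivative of the sawtooth -/
noncomputable def sawP (y : ℝ) : ℝ := (Int.fract y ^ 2 - Int.fract y) / 2

lemma sawP_abs_le (y : ℝ) : |sawP y| ≤ 1 / 8 := by
  unfold sawP
  have h1 := Int.fract_nonneg y
  have h2 := (Int.fract_lt_one y).le
  rw [abs_le]; constructor <;> nlinarith [sq_nonneg (Int.fract y - 1 / 2)]

lemma sawP_step (y d : ℝ) (hd : 0 < d) :
    |sawt y - (sawP (y + d) - sawP y) * (1 / d)| ≤ d / 2 + (⌊y + d⌋ - ⌊y⌋ : ℤ) := by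
  have s0 := Int.fract_nonneg y
  have s1 := Int.fract_lt_one y
  have t0 := Int.fract_nonneg (y + d)
  have t1 := Int.fract_lt_one (y + d)
  have hs : Int.fract y = y - ⌊y⌋ := rfl
  have ht : Int.fract (y + d) = y + d - ⌊y + d⌋ := rfl
  have hmono : ⌊y⌋ ≤ ⌊y + d⌋ := Int.floor_mono (by linarith)
  set s := Int.fract y with hsd
  set t := Int.fract (y + d) with htd
  rcases hmono.eq_or_lt with he | hlt
  · have : t = s + d := by rw [hs, ht, he]; ring
    have e : sawt y - (sawP (y + d) - sawP y) * (1 / d) = - (d / 2) := by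
      unfold sawt sawP
      rw [← hsd, ← htd, this]
      field_simp
      ring
    rw [e, abs_neg, abs_of_pos (by linarith), he]; simp
  · have h1 : (1 : ℝ) ≤ ((⌊y + d⌋ - ⌊y⌋ : ℤ) : ℝ) := by
      exact_mod_cast (by omega : (1 : ℤ) ≤ ⌊y + d⌋ - ⌊y⌋)
    have h2 : 1 - s + t ≤ d := by
      push_cast at h1
      rw [hs, ht]; linarith
    have h3 : |sawP (y + d) - sawP y| ≤ d / 2 := by
      unfold sawP
      rw [← hsd, ← htd, abs_le]
      constructor <;> nlinarith
    have h4 : |(sawP (y + d) - sawP y) * (1 / d)| ≤ 1 / 2 := by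
      rw [abs_mul, abs_of_pos (by positivity : 0 < 1 / d)]
      calc _ ≤ d / 2 * (1 / d) := by gcongr
        _ = 1 / 2 := by field_simp
    have h5 := sawt_abs_le y
    have := abs_sub (sawt y) ((sawP (y + d) - sawP y) * (1 / d))
    linarith

lemma abel_bound (P w : ℕ → ℝ) (c : ℝ) (hP : ∀ n, |P n| ≤ c)
    (hw : Antitone w) (hw0 : ∀ n, 0 ≤ w n) (m n : ℕ) (hmn : m ≤ n) :
    |∑ a ∈ Finset.Ico m n, (P (a + 1) - P a) * w a| ≤ 2 * c * w m := by
  have key : |∑ a ∈ Finset.Ico m n, (P (a + 1) - P a) * w a - P n * w n| ≤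
      2 * c * w m - c * w n := by
    induction n, hmn using Nat.le_induction with
    | base =>
      simp only [Finset.Ico_self, Finset.sum_empty, zero_sub, abs_neg, abs_mul, abs_of_nonneg (hw0 m)]
      have := mul_le_mul_of_nonneg_right (hP m) (hw0 m)
      linarith
    | succ n hmn ih =>
      rw [Finset.sum_Ico_succ_top hmn]
      have e : ∑ k ∈ Finset.Ico m n, (P (k + 1) - P k) * w k + (P (n + 1) - P n) * w n
          - P (n + 1) * w (n + 1) = (∑ k ∈ Finset.Ico m n, (P (k + 1) - P k) * w k - P n * w n)
          + P (n + 1) * (w n - w (n + 1)) := by ring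
      rw [e]
      have h1 : 0 ≤ w n - w (n + 1) := sub_nonneg.2 (hw (Nat.le_succ n))
      have h2 : |P (n + 1) * (w n - w (n + 1))| ≤ c * (w n - w (n + 1)) := by
        rw [abs_mul, abs_of_nonneg h1]
        exact mul_le_mul_of_nonneg_right (hP _) h1
      have := abs_add_le (∑ k ∈ Finset.Ico m n, (P (k + 1) - P k) * w k - P n * w n)
        (P (n + 1) * (w n - w (n + 1)))
      linarith
  have h2 : |P n * w n| ≤ c * w n := by
    rw [abs_mul, abs_of_nonneg (hw0 n)]
    exact mul_le_mul_of_nonneg_right (hP _) (hw0 n)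
  have := abs_add_le (∑ a ∈ Finset.Ico m n, (P (a + 1) - P a) * w a - P n * w n) (P n * w n)
  rw [sub_add_cancel] at this
  linarith

/-- slow range -/
lemma slow_bound (α : ℝ) (hα : 0 < α) (m n : ℕ) (hmn : m ≤ n) :
    |∑ a ∈ Finset.Ico m n, sawt (α * (a : ℝ) ^ 2)| ≤
      1 / (α * (2 * m + 1)) + 2 * (α * (n : ℝ) ^ 2) + 1 := by
  set f : ℕ → ℝ := fun a => α * (a : ℝ) ^ 2 with hf
  set w : ℕ → ℝ := fun a => 1 / (α * (2 * a + 1)) with hw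
  have hd : ∀ a, f (a + 1) = f a + α * (2 * a + 1) := by
    intro a; simp only [hf]; push_cast; ring
  have h1 := abel_bound (fun a => sawP (f a)) w (1 / 8) (fun _ => sawP_abs_le _)
    (by
      intro a b hab
      simp only [hw]
      have : (a : ℝ) ≤ b := by exact_mod_cast hab
      gcongr) (by intro a; simp only [hw]; positivity) m n hmn
  have h2 : |∑ a ∈ Finset.Ico m n, (sawt (f a) - (sawP (f (a + 1)) - sawP (f a)) * w a)| ≤
      ∑ a ∈ Finset.Ico m n, ((f (a + 1) - f a) / 2 + (((⌊f (a + 1)⌋ : ℤ) : ℝ) - (⌊f a⌋ : ℤ))) := by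
    refine (Finset.abs_sum_le_sum_abs _ _).trans (Finset.sum_le_sum ?_)
    intro a _
    have := sawP_step (f a) (α * (2 * a + 1)) (by positivity)
    rw [← hd] at this
    push_cast at this
    simp only [hw]
    rw [hd] at this ⊢
    linarith
  have h3 : ∑ a ∈ Finset.Ico m n, ((f (a + 1) - f a) / 2 + (((⌊f (a + 1)⌋ : ℤ) : ℝ) - (⌊f a⌋ : ℤ)))
      = (f n - f m) / 2 + ((⌊f n⌋ : ℤ) - (⌊f m⌋ : ℤ)) := by
    rw [Finset.sum_add_distrib, ← Finset.sum_div, Finset.sum_Ico_sub f hmn,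
      Finset.sum_Ico_sub (fun a => ((⌊f a⌋ : ℤ) : ℝ)) hmn]
  rw [h3, Finset.sum_sub_distrib] at h2
  have f0 : 0 ≤ f m := by simp only [hf]; positivity
  have fn : 0 ≤ f n := by simp only [hf]; positivity
  have g1 := Int.floor_le (f n)
  have g2 : (0 : ℝ) ≤ (⌊f m⌋ : ℤ) := by exact_mod_cast Int.floor_nonneg.2 f0
  have wm : 0 ≤ w m := by simp only [hw]; positivity
  have := abs_add_le (∑ a ∈ Finset.Ico m n, sawt (f a) - ∑ a ∈ Finset.Ico m n, (sawP (f (a + 1)) - sawP (f a)) * w a) (∑ a ∈ Finset.Ico m n, (sawP (f (a + 1)) - sawP (f a)) * w a)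
  rw [sub_add_cancel] at this
  change |∑ a ∈ Finset.Ico m n, sawt (f a)| ≤ w m + 2 * f n + 1
  linarith

lemma greedy (g : ℕ → ℝ) (hg : ∀ n, |g n| ≤ 1 / 2) (ℓ : ℕ → ℕ) (Q : ℕ) (c : ℝ)
    (hℓ1 : ∀ n, 1 ≤ ℓ n) (hℓQ : ∀ n, ℓ n ≤ Q)
    (hc : ∀ a, |∑ j ∈ Finset.range (ℓ a), g (a + j)| ≤ c) (N : ℕ) :
    ∀ d m : ℕ, N - m ≤ d → ∃ S : Finset ℕ, S ⊆ Finset.Ico m N ∧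
      |∑ a ∈ Finset.Ico m N, g a| ≤ c * S.card + Q ∧
      ∀ s ∈ S, ∀ s' ∈ S, s < s' → s + ℓ s ≤ s' := by
  intro d
  induction d with
  | zero =>
    intro m hm
    refine ⟨∅, by simp, ?_, by simp⟩
    rw [Finset.Ico_eq_empty (by omega)]
    simp
  | succ d ih =>
    intro m hm
    by_cases h : N < m + ℓ m
    · refine ⟨∅, by simp, ?_, by simp⟩
      have h1 := Finset.abs_sum_le_sum_abs g (Finset.Ico m N)
      have h2 : ∑ a ∈ Finset.Ico m N, |g a| ≤ ∑ a ∈ Finset.Ico m N, (1 / 2 : ℝ) :=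
        Finset.sum_le_sum (fun a _ => hg a)
      simp only [Finset.sum_const, Nat.card_Ico, nsmul_eq_mul] at h2
      have h3 : ((N - m : ℕ) : ℝ) ≤ Q := by
        have := hℓQ m
        exact_mod_cast (by omega : N - m ≤ Q)
      simp only [Finset.card_empty, Nat.cast_zero, mul_zero, zero_add]
      have : (0 : ℝ) ≤ ((N - m : ℕ) : ℝ) := by positivity
      linarith
    · push Not at h
      have := hℓ1 m
      obtain ⟨S, hS1, hS2, hS3⟩ := ih (m + ℓ m) (by omega)
      have hmS : m ∉ S := by
        intro hm'
        have := Finset.mem_Ico.1 (hS1 hm')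
        omega
      refine ⟨insert m S, ?_, ?_, ?_⟩
      · intro x hx
        rcases Finset.mem_insert.1 hx with rfl | hx
        · simp; omega
        · have := Finset.mem_Ico.1 (hS1 hx)
          simp; omega
      · rw [Finset.card_insert_of_notMem hmS]
        rw [← Finset.sum_Ico_consecutive g (by omega : m ≤ m + ℓ m) h]
        have e : ∑ i ∈ Finset.Ico m (m + ℓ m), g i = ∑ j ∈ Finset.range (ℓ m), g (m + j) := by
          rw [Finset.sum_Ico_eq_sum_range]; simp
        rw [e]
        have h1 := abs_add_le (∑ j ∈ Finset.range (ℓ m), g (m + j))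
          (∑ i ∈ Finset.Ico (m + ℓ m) N, g i)
        have h2 := hc m
        push_cast
        linarith
      · intro s hs s' hs' hlt
        rcases Finset.mem_insert.1 hs with rfl | hs
        · rcases Finset.mem_insert.1 hs' with rfl | hs'
          · omega
          · exact (Finset.mem_Ico.1 (hS1 hs')).1
        · rcases Finset.mem_insert.1 hs' with rfl | hs'
          · have := (Finset.mem_Ico.1 (hS1 (by assumption : s ∈ S))).1
            omega
          · exact hS3 s hs s' hs' hlt

lemma spaced_card (S : Finset ℕ) (q : ℕ) (hq : 1 ≤ q)
    (hS : ∀ s ∈ S, ∀ s' ∈ S, s < s' → s + q ≤ s') (L : ℝ) (hL0 : 0 ≤ L)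
    (hL : ∀ s ∈ S, ∀ s' ∈ S, (s' : ℝ) - s ≤ L) : (S.card : ℝ) ≤ L / q + 1 := by
  have hqR : (0 : ℝ) < q := by exact_mod_cast hq
  rcases S.eq_empty_or_nonempty with rfl | hne
  · simp; positivity
  have hdisj : (S : Set ℕ).PairwiseDisjoint (fun s => Finset.Ico s (s + q)) := by
    intro s hs s' hs' hne'
    simp only [Function.onFun]
    rw [Finset.disjoint_left]
    intro x hx hx'
    simp only [Finset.mem_Ico] at hx hx'
    rcases lt_or_gt_of_ne hne' with h | h
    · have := hS s hs s' hs' h; omega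
    · have := hS s' hs' s hs h; omega
  have hcard := Finset.card_biUnion hdisj
  simp only [Nat.card_Ico, add_tsub_cancel_left, Finset.sum_const, smul_eq_mul] at hcard
  have hsub : S.biUnion (fun s => Finset.Ico s (s + q)) ⊆
      Finset.Ico (S.min' hne) (S.max' hne + q) := by
    intro x hx
    obtain ⟨s, hs, hx⟩ := Finset.mem_biUnion.1 hx
    have h1 := S.min'_le s hs
    have h2 := S.le_max' s hs
    simp only [Finset.mem_Ico] at hx ⊢
    omega
  have h3 := Finset.card_le_card hsub
  rw [hcard, Nat.card_Ico] at h3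
  have h4 : S.card * q + S.min' hne ≤ S.max' hne + q := by
    have := S.min'_le _ (S.max'_mem hne)
    omega
  have h5 := hL _ (S.min'_mem hne) _ (S.max'_mem hne)
  have h4' : (S.card : ℝ) * q + (S.min' hne : ℕ) ≤ (S.max' hne : ℕ) + q := by exact_mod_cast h4
  rw [div_add_one hqR.ne', le_div_iff₀ hqR]
  linarith

lemma fast_bound (α : ℝ) (hα : 0 < α) (Q : ℕ) (hQ : 1 ≤ Q) (hαQ : α * (Q : ℝ) ^ 3 ≤ 1)
    (m N : ℕ) (hm : 1 / ((Q : ℝ) + 1) < 2 * α * m) :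
    |∑ a ∈ Finset.Ico m N, sawt (α * (a : ℝ) ^ 2)| ≤
      80 * (N * (1 + Real.log Q) / Q) + Q := by
  have hQR : (1 : ℝ) ≤ Q := by exact_mod_cast hQ
  have hex := fun a : ℕ => Real.exists_rat_abs_sub_le_and_den_le (2 * α * a) (n := Q) (by omega)
  choose r hr hrQ using hex
  have hden : ∀ a, (1 : ℝ) ≤ (r a).den := fun a => by exact_mod_cast (r a).den_pos
  have hblock : ∀ a : ℕ, |∑ j ∈ Finset.range (r a).den, sawt (α * ((a + j : ℕ) : ℝ) ^ 2)| ≤ 10 := by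
    intro a
    have hd : ((r a).den : ℝ) ≤ Q := by exact_mod_cast hrQ a
    have hd1 := hden a
    have h1 := block_bound (α * (a : ℝ) ^ 2) (2 * α * a) α (r a) ?_ hα.le ?_
    · convert h1 using 4 with j hj
      push_cast; ring
    · refine (hr a).trans ?_
      apply one_div_le_one_div_of_le (by positivity)
      nlinarith
    · refine le_trans ?_ hαQ
      gcongr
  obtain ⟨S, hS1, hS2, hS3⟩ := greedy (fun a => sawt (α * (a : ℝ) ^ 2)) (fun _ => sawt_abs_le _)
    (fun a => (r a).den) Q 10 (fun a => (r a).den_pos) hrQ hblock N (N - m) m le_rfl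
  refine hS2.trans ?_
  have hnum : ∀ s ∈ S, 1 ≤ (r s).num ∧
      ((r s).num : ℝ) ≤ 2 * α * N * (r s).den + 1 / 2 := by
    intro s hs
    have hsI := Finset.mem_Ico.1 (hS1 hs)
    have hms : (m : ℝ) ≤ s := by exact_mod_cast hsI.1
    have hsN : (s : ℝ) ≤ N := by exact_mod_cast hsI.2.le
    have hd1 := hden s
    have hrr : ((r s : ℚ) : ℝ) = (r s).num / (r s).den := by
      exact_mod_cast (Rat.num_div_den (r s)).symm
    have h1 := hr s
    rw [hrr] at h1
    have h2 : |2 * α * s * (r s).den - (r s).num| ≤ 1 / ((Q : ℝ) + 1) := by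
      have e : 2 * α * s * (r s).den - (r s).num =
          (2 * α * s - (r s).num / (r s).den) * (r s).den := by
        field_simp
      rw [e, abs_mul, abs_of_pos (by linarith : (0 : ℝ) < (r s).den)]
      calc _ ≤ 1 / (((Q : ℝ) + 1) * (r s).den) * (r s).den := by gcongr
        _ = _ := by field_simp
    rw [abs_le] at h2
    have h3 : 2 * α * m ≤ 2 * α * s := by gcongr
    have h4 : 2 * α * s ≤ 2 * α * s * (r s).den := by
      apply le_mul_of_one_le_right _ hd1
      positivity
    have h5 : 2 * α * s * (r s).den ≤ 2 * α * N * (r s).den := by gcongr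
    have h6 : 1 / ((Q : ℝ) + 1) ≤ 1 / 2 := by
      apply one_div_le_one_div_of_le <;> linarith
    constructor
    · have : (0 : ℝ) < (r s).num := by linarith
      have : 0 < (r s).num := by exact_mod_cast this
      omega
    · linarith
  have hcell : ∀ q ∈ Finset.Icc 1 Q, ∀ p : ℤ,
      (((S.filter (fun s => (r s).den = q)).filter (fun s => (r s).num = p)).card : ℝ) ≤
        1 / (α * Q * (q : ℝ) ^ 2) + 1 := by
    intro q hq p
    have hq1 : (1 : ℝ) ≤ q := by exact_mod_cast (Finset.mem_Icc.1 hq).1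
    have h1 := spaced_card ((S.filter (fun s => (r s).den = q)).filter (fun s => (r s).num = p)) q
      (Finset.mem_Icc.1 hq).1 ?_ (1 / (α * Q * q)) (by positivity) ?_
    · refine h1.trans (le_of_eq ?_)
      field_simp
    · intro s hs s' hs' hlt
      simp only [Finset.mem_filter] at hs hs'
      have := hS3 s hs.1.1 s' hs'.1.1 hlt
      rw [hs.1.2] at this
      exact this
    · intro s hs s' hs'
      simp only [Finset.mem_filter] at hs hs'
      have e : (r s : ℝ) = r s' := by
        have : r s = r s' := by
          rw [← Rat.num_div_den (r s), ← Rat.num_div_den (r s'), hs.2, hs'.2, hs.1.2, hs'.1.2]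
        rw [this]
      have h1 := hr s
      have h2 := hr s'
      rw [hs.1.2, e] at h1
      rw [hs'.1.2] at h2
      rw [abs_le] at h1 h2
      have h3 : 2 * α * ((s' : ℝ) - s) ≤ 2 * (1 / (((Q : ℝ) + 1) * q)) := by linarith
      have h4 : 1 / (((Q : ℝ) + 1) * q) ≤ 1 / (Q * q) := by
        apply one_div_le_one_div_of_le (by positivity)
        gcongr; linarith
      have h5 : α * ((s' : ℝ) - s) ≤ 1 / (Q * q) := by linarith
      rw [le_div_iff₀ (by positivity)]
      rw [le_div_iff₀ (by positivity)] at h5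
      linarith
  have hrow : ∀ q ∈ Finset.Icc 1 Q, ((S.filter (fun s => (r s).den = q)).card : ℝ) ≤
      4 * α * N * q * (1 / (α * Q * (q : ℝ) ^ 2) + 1) := by
    intro q hq
    have hq1 : (1 : ℝ) ≤ q := by exact_mod_cast (Finset.mem_Icc.1 hq).1
    set B := 2 * α * N * q with hB
    have hB0 : 0 ≤ B := by positivity
    have hmaps : ∀ s ∈ S.filter (fun s => (r s).den = q), (r s).num ∈ Finset.Icc 1 ⌊B + 1 / 2⌋ := by
      intro s hs
      simp only [Finset.mem_filter] at hs
      obtain ⟨h1, h2⟩ := hnum s hs.1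
      rw [Finset.mem_Icc]
      refine ⟨h1, Int.le_floor.2 ?_⟩
      rw [hs.2] at h2
      exact h2
    rw [Finset.card_eq_sum_card_fiberwise hmaps]
    push_cast
    refine (Finset.sum_le_sum (fun p _ => hcell q hq p)).trans ?_
    rw [Finset.sum_const, nsmul_eq_mul]
    apply mul_le_mul_of_nonneg_right _ (by positivity)
    have e : 4 * α * N * q = 2 * B := by rw [hB]; ring
    rw [e, Int.card_Icc]
    have h0 : 0 ≤ ⌊B + 1 / 2⌋ := Int.floor_nonneg.2 (by linarith)
    have h1 : ((⌊B + 1 / 2⌋ + 1 - 1).toNat : ℝ) = ⌊B + 1 / 2⌋ := by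
      have : ((⌊B + 1 / 2⌋ + 1 - 1).toNat : ℤ) = ⌊B + 1 / 2⌋ := by omega
      exact_mod_cast this
    rw [h1]
    by_cases h : ⌊B + 1 / 2⌋ = 0
    · rw [h]; simp; linarith
    · have h2 : (1 : ℝ) ≤ ⌊B + 1 / 2⌋ := by exact_mod_cast (by omega : (1 : ℤ) ≤ ⌊B + 1 / 2⌋)
      have h3 := Int.floor_le (B + 1 / 2)
      linarith
  have hmaps : ∀ s ∈ S, (r s).den ∈ Finset.Icc 1 Q := by
    intro s _
    exact Finset.mem_Icc.2 ⟨(r s).den_pos, hrQ s⟩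
  have hcardS : (S.card : ℝ) ≤ 8 * (N * (1 + Real.log Q) / Q) := by
    rw [Finset.card_eq_sum_card_fiberwise hmaps]
    push_cast
    refine (Finset.sum_le_sum hrow).trans ?_
    have e : ∀ q ∈ Finset.Icc 1 Q, 4 * α * N * q * (1 / (α * Q * (q : ℝ) ^ 2) + 1) ≤
        4 * N / Q * (q : ℝ)⁻¹ + 4 * N * α * Q := by
      intro q hq
      have hq1 : (1 : ℝ) ≤ q := by exact_mod_cast (Finset.mem_Icc.1 hq).1
      have hq2 : (q : ℝ) ≤ Q := by exact_mod_cast (Finset.mem_Icc.1 hq).2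
      have e1 : 4 * α * N * q * (1 / (α * Q * (q : ℝ) ^ 2) + 1) =
        4 * N / Q * (q : ℝ)⁻¹ + 4 * N * α * q := by
        field_simp
      rw [e1]
      gcongr
    refine (Finset.sum_le_sum e).trans ?_
    rw [Finset.sum_add_distrib, ← Finset.mul_sum, Finset.sum_const, Nat.card_Icc, nsmul_eq_mul]
    have hh := harmonic_le_one_add_log Q
    rw [harmonic_eq_sum_Icc] at hh
    push_cast at hh
    have hlog : 0 ≤ Real.log Q := Real.log_nonneg hQR
    have t1 : 4 * N / Q * ∑ q ∈ Finset.Icc 1 Q, (q : ℝ)⁻¹ ≤ 4 * (N * (1 + Real.log Q) / Q) := by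
      calc _ ≤ 4 * N / Q * (1 + Real.log Q) := by gcongr
        _ = _ := by ring
    have t2 : ((Q + 1 - 1 : ℕ) : ℝ) * (4 * N * α * Q) ≤ 4 * (N * (1 + Real.log Q) / Q) := by
      rw [Nat.add_sub_cancel]
      have : (Q : ℝ) * (4 * N * α * Q) = 4 * (N * (α * (Q : ℝ) ^ 3) / Q) := by
        field_simp
      rw [this]
      gcongr
      linarith
    linarith
  linarith

/-- The discrepancy bound for quadratic sequences. -/
lemma disc_bound (α : ℝ) (hα : 0 < α) (Q : ℕ) (hQ : 1 ≤ Q) (hαQ : α * (Q : ℝ) ^ 3 ≤ 1)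
    (hαQ' : 1 ≤ α * ((Q : ℝ) + 1) ^ 3) (N : ℕ) :
    |∑ a ∈ Finset.range N, sawt (α * (a : ℝ) ^ 2)| ≤
      80 * (N * (1 + Real.log Q) / Q) + 30 * (1 / Real.sqrt α) := by
  have hQR : (1 : ℝ) ≤ Q := by exact_mod_cast hQ
  have hlog : 0 ≤ Real.log Q := Real.log_nonneg hQR
  set σ := Real.sqrt α with hσ
  have hσ0 : 0 < σ := Real.sqrt_pos.2 hα
  have hσ2 : σ ^ 2 = α := Real.sq_sqrt hα.le
  have hα1 : α ≤ 1 := by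
    have : (1 : ℝ) ≤ (Q : ℝ) ^ 3 := one_le_pow₀ hQR
    nlinarith
  have hσ1 : σ ≤ 1 := by nlinarith
  have hinv1 : 1 ≤ 1 / σ := by rw [le_div_iff₀ hσ0]; linarith
  have hQσ : (Q : ℝ) ≤ 1 / σ := by
    rw [le_div_iff₀ hσ0]
    have : ((Q : ℝ) * σ) ^ 2 ≤ 1 ^ 2 := by
      rw [mul_pow, hσ2]
      calc (Q : ℝ) ^ 2 * α ≤ (Q : ℝ) ^ 3 * α := by
            gcongr
            norm_num
        _ ≤ 1 ^ 2 := by linarith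
    exact le_of_sq_le_sq this (by norm_num)
  have triv : ∀ n : ℕ, |∑ a ∈ Finset.range n, sawt (α * (a : ℝ) ^ 2)| ≤ n := by
    intro n
    refine (Finset.abs_sum_le_sum_abs _ _).trans ?_
    refine (Finset.sum_le_sum (fun a _ => sawt_abs_le _)).trans ?_
    simp; linarith [(Nat.cast_nonneg n : (0 : ℝ) ≤ n)]
  have hmain0 : 0 ≤ 80 * (N * (1 + Real.log Q) / Q) := by positivity
  set a1 := ⌈1 / σ⌉₊ with ha1
  have ha1le : (a1 : ℝ) ≤ 2 * (1 / σ) := by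
    have := Nat.ceil_lt_add_one (by positivity : 0 ≤ 1 / σ)
    linarith
  have ha1ge : 1 / σ ≤ a1 := Nat.le_ceil _
  rcases le_or_gt N a1 with hN | hN
  · have := triv N
    have h2 : (N : ℝ) ≤ a1 := by exact_mod_cast hN
    linarith
  set a0' := ⌊1 / (2 * α * (Q + 1))⌋₊ + 1 with ha0'
  have ha0gt : 1 / ((Q : ℝ) + 1) < 2 * α * a0' := by
    have := Nat.lt_floor_add_one (1 / (2 * α * ((Q : ℝ) + 1)))
    rw [div_lt_iff₀ (by positivity)] at this ⊢
    rw [ha0']; push_cast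
    linarith
  have ha0le : (a0' : ℝ) ≤ 1 / (2 * α * Q) + 1 := by
    rw [ha0']; push_cast
    have := Nat.floor_le (by positivity : 0 ≤ 1 / (2 * α * ((Q : ℝ) + 1)))
    have h2 : 1 / (2 * α * ((Q : ℝ) + 1)) ≤ 1 / (2 * α * Q) := by
      apply one_div_le_one_div_of_le (by positivity)
      gcongr; linarith
    linarith
  -- value of the phase at the transition point
  have hfa0 : α * (a0' : ℝ) ^ 2 ≤ 4 * Q + 2 := by
    have h8 : ((Q : ℝ) + 1) ^ 3 ≤ (2 * Q) ^ 3 := by gcongr; linarith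
    have h1 : 1 ≤ α * (8 * (Q : ℝ) ^ 3) := by
      refine hαQ'.trans ?_
      have : (2 * (Q : ℝ)) ^ 3 = 8 * (Q : ℝ) ^ 3 := by ring
      rw [← this]; gcongr
    have h2 : (a0' : ℝ) ^ 2 ≤ (1 / (2 * α * Q) + 1) ^ 2 := by gcongr
    have h3 : (1 / (2 * α * Q) + 1) ^ 2 ≤ 2 * (1 / (2 * α * Q)) ^ 2 + 2 := by
      nlinarith [sq_nonneg (1 / (2 * α * Q) - 1)]
    have h4 : α * (2 * (1 / (2 * α * Q)) ^ 2) = 1 / (2 * α * (Q : ℝ) ^ 2) := by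
      field_simp
      try norm_num
    have h5 : 1 / (2 * α * (Q : ℝ) ^ 2) ≤ 4 * Q := by
      rw [div_le_iff₀ (by positivity)]
      nlinarith
    calc α * (a0' : ℝ) ^ 2 ≤ α * (2 * (1 / (2 * α * Q)) ^ 2 + 2) := by
          gcongr; exact h2.trans h3
      _ = 1 / (2 * α * (Q : ℝ) ^ 2) + 2 * α := by rw [mul_add, h4]; ring
      _ ≤ 4 * Q + 2 := by linarith
  have hslowterm : 1 / (α * (2 * (a1 : ℝ) + 1)) ≤ 1 / σ := by
    apply one_div_le_one_div_of_le hσ0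
    have h1 : 1 ≤ σ * a1 := by
      rw [div_le_iff₀ hσ0] at ha1ge; linarith
    rw [← hσ2]
    nlinarith
  set M := min N (max a1 a0') with hM
  have hM1 : a1 ≤ M := le_min hN.le (le_max_left _ _)
  have hfM : a1 < a0' → α * (M : ℝ) ^ 2 ≤ 4 * Q + 2 := by
    intro h
    refine le_trans ?_ hfa0
    have : (M : ℝ) ≤ a0' := by
      have : M ≤ a0' := by rw [hM]; omega
      exact_mod_cast this
    gcongr
  have hslow : |∑ a ∈ Finset.Ico a1 M, sawt (α * (a : ℝ) ^ 2)| ≤ 1 / σ + 2 * (4 * Q + 2) + 1 := by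
    rcases le_or_gt a0' a1 with h | h
    · have : M = a1 := by rw [hM]; omega
      rw [this]; simp; positivity
    · have := slow_bound α hα a1 M hM1
      have := hfM h
      linarith
  have hfast : |∑ a ∈ Finset.Ico M N, sawt (α * (a : ℝ) ^ 2)| ≤
      80 * (N * (1 + Real.log Q) / Q) + Q := by
    rcases le_or_gt N (max a1 a0') with h | h
    · have : M = N := by rw [hM]; omega
      rw [this]; simp only [Finset.Ico_self, Finset.sum_empty, abs_zero]; positivity
    · apply fast_bound α hα Q hQ hαQ
      refine ha0gt.trans_le ?_
      have : (a0' : ℝ) ≤ M := by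
        have : a0' ≤ M := by rw [hM]; omega
        exact_mod_cast this
      gcongr
  have hMN : M ≤ N := min_le_left _ _
  rw [Finset.range_eq_Ico, ← Finset.sum_Ico_consecutive _ (Nat.zero_le a1) hN.le,
    ← Finset.sum_Ico_consecutive _ hM1 hMN, ← Finset.range_eq_Ico]
  have h1 := triv a1
  have h2 := abs_add_le (∑ i ∈ Finset.range a1, sawt (α * (i : ℝ) ^ 2))
    (∑ i ∈ Finset.Ico a1 M, sawt (α * (i : ℝ) ^ 2) + ∑ i ∈ Finset.Ico M N, sawt (α * (i : ℝ) ^ 2))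
  have h3 := abs_add_le (∑ i ∈ Finset.Ico a1 M, sawt (α * (i : ℝ) ^ 2))
    (∑ i ∈ Finset.Ico M N, sawt (α * (i : ℝ) ^ 2))
  linarith

lemma sum_moebius_gcd (m : ℕ) :
    ∑ e ∈ m.divisors, ((ArithmeticFunction.moebius e : ℤ) : ℝ) = if m = 1 then 1 else 0 := by
  have h := congrArg (fun f : ArithmeticFunction ℤ => f m)
    ArithmeticFunction.moebius_mul_coe_zeta
  simp only [ArithmeticFunction.coe_mul_zeta_apply, ArithmeticFunction.one_apply] at h
  have h2 := congrArg (Int.cast : ℤ → ℝ) h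
  push_cast at h2
  exact h2

lemma coprime_sum (φ : ℚ → ℝ) (b : ℕ) (hb : 0 < b) :
    ∑ a ∈ (Finset.range b).filter (fun a => Nat.gcd a b = 1), φ ((a : ℚ) / b) =
    ∑ e ∈ b.divisors, ((ArithmeticFunction.moebius e : ℤ) : ℝ) *
      ∑ a ∈ Finset.range (b / e), φ ((a : ℚ) / (b / e : ℕ)) := by
  rw [Finset.sum_filter]
  have h1 : ∀ a ∈ Finset.range b, (if Nat.gcd a b = 1 then φ ((a : ℚ) / b) else 0) =
      ∑ e ∈ b.divisors, if e ∣ a then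
        ((ArithmeticFunction.moebius e : ℤ) : ℝ) * φ ((a : ℚ) / b) else 0 := by
    intro a _
    have h2 : (if Nat.gcd a b = 1 then φ ((a : ℚ) / b) else 0) =
        (if Nat.gcd a b = 1 then (1 : ℝ) else 0) * φ ((a : ℚ) / b) := by
      split_ifs <;> simp
    rw [h2, ← sum_moebius_gcd, Finset.sum_mul, ← Finset.sum_filter]
    apply Finset.sum_congr _ (fun _ _ => rfl)
    ext e
    simp only [Nat.mem_divisors, Finset.mem_filter, Nat.dvd_gcd_iff]
    have : Nat.gcd a b ≠ 0 := (Nat.gcd_pos_of_pos_right a hb).ne'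
    constructor
    · rintro ⟨⟨h1, h2⟩, _⟩; exact ⟨⟨h2, hb.ne'⟩, h1⟩
    · rintro ⟨⟨h1, _⟩, h2⟩; exact ⟨⟨h2, h1⟩, this⟩
  rw [Finset.sum_congr rfl h1, Finset.sum_comm]
  apply Finset.sum_congr rfl
  intro e he
  obtain ⟨c, rfl⟩ := (Nat.mem_divisors.1 he).1
  have he0 : 0 < e := Nat.pos_of_mul_pos_right hb
  rw [Nat.mul_div_cancel_left c he0, ← Finset.sum_filter, Finset.mul_sum]
  symm
  apply Finset.sum_nbij (fun a => e * a)
  · intro a ha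
    simp only [Finset.mem_range, Finset.mem_filter] at ha ⊢
    exact ⟨Nat.mul_lt_mul_of_pos_left ha he0, dvd_mul_right _ _⟩
  · intro a _ a' _ h
    exact Nat.eq_of_mul_eq_mul_left he0 h
  · intro x hx
    simp only [Finset.coe_filter, Finset.mem_range, Set.mem_ofPred_eq] at hx
    obtain ⟨hx1, a, rfl⟩ := hx
    exact ⟨a, by simpa using Nat.lt_of_mul_lt_mul_left hx1, rfl⟩
  · intro a _
    have : (e : ℚ) ≠ 0 := by exact_mod_cast he0.ne'
    push_cast
    rw [mul_div_mul_left _ _ this]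

lemma farey_sum_eq (φ : ℚ → ℝ) (T : ℕ) :
    ∑ ξ ∈ farey T, φ ξ = ∑ b ∈ Finset.Ioc 0 T,
      ∑ a ∈ (Finset.range b).filter (fun a => Nat.gcd a b = 1), φ ((a : ℚ) / b) := by
  unfold farey
  rw [Finset.sum_image]
  · rw [Finset.sum_sigma']
    apply Finset.sum_nbij' (fun p => (⟨p.2, p.1⟩ : (_ : ℕ) × ℕ)) (fun s => (s.2, s.1))
    · intro p hp
      simp only [Finset.mem_filter, Finset.mem_product, Finset.mem_range, Finset.mem_sigma,
        Finset.mem_Ioc] at hp ⊢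
      exact ⟨⟨by omega, by omega⟩, hp.2.1, hp.2.2⟩
    · intro s hs
      simp only [Finset.mem_filter, Finset.mem_product, Finset.mem_range, Finset.mem_sigma,
        Finset.mem_Ioc] at hs ⊢
      exact ⟨⟨by omega, by omega⟩, hs.2.1, hs.2.2⟩
    · intro p _; rfl
    · intro s _; rfl
    · intro p _; rfl
  · intro p hp p' hp' h
    simp only [Finset.coe_filter, Finset.mem_product, Finset.mem_range, Set.mem_ofPred_eq] at hp hp'
    have hb : 0 < p.2 := by omega
    have hb' : 0 < p'.2 := by omega
    have h1 : ((p.1 : ℤ) : ℚ) / ((p.2 : ℤ) : ℚ) = ((p'.1 : ℤ) : ℚ) / ((p'.2 : ℤ) : ℚ) := by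
      simpa using h
    have h2 := Rat.div_int_inj (by exact_mod_cast hb) (by exact_mod_cast hb')
      (by simpa [Nat.Coprime] using hp.2.2) (by simpa [Nat.Coprime] using hp'.2.2) h1
    ext
    · exact_mod_cast h2.1
    · exact_mod_cast h2.2

lemma farey_sum (φ : ℚ → ℝ) (T : ℕ) :
    ∑ ξ ∈ farey T, φ ξ = ∑ n ∈ Finset.Ioc 0 T, (mertens (T / n) : ℝ) *
      ∑ a ∈ Finset.range n, φ ((a : ℚ) / n) := by
  rw [farey_sum_eq]
  set W : ArithmeticFunction ℝ :=
    ⟨fun n => ∑ a ∈ Finset.range n, φ ((a : ℚ) / n), by simp⟩ with hW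
  have hWa : ∀ n, W n = ∑ a ∈ Finset.range n, φ ((a : ℚ) / n) := fun n => rfl
  have h := ArithmeticFunction.sum_Ioc_mul_eq_sum_sum W
    ((ArithmeticFunction.moebius : ArithmeticFunction ℤ) : ArithmeticFunction ℝ) T
  have e1 : ∀ b ∈ Finset.Ioc 0 T,
      ∑ a ∈ (Finset.range b).filter (fun a => Nat.gcd a b = 1), φ ((a : ℚ) / b) =
      (W * ((ArithmeticFunction.moebius : ArithmeticFunction ℤ) : ArithmeticFunction ℝ)) b := by
    intro b hb
    rw [coprime_sum φ b (Finset.mem_Ioc.1 hb).1, mul_comm, ArithmeticFunction.mul_apply,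
      Nat.sum_divisorsAntidiagonal (fun x y =>
        ((ArithmeticFunction.moebius : ArithmeticFunction ℤ) : ArithmeticFunction ℝ) x * W y)]
    rfl
  rw [Finset.sum_congr rfl e1, h]
  apply Finset.sum_congr rfl
  intro n _
  rw [hWa, mul_comm]
  congr 1
  unfold mertens
  push_cast
  rfl

lemma sum_mertens (T : ℕ) (hT : 1 ≤ T) : ∑ n ∈ Finset.Ioc 0 T, (mertens (T / n) : ℝ) = 1 := by
  have h := farey_sum (fun ξ => if ξ = 0 then 1 else 0) T
  have h0 : (0 : ℚ) ∈ farey T := by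
    unfold farey
    refine Finset.mem_image.2 ⟨(0, 1), ?_, by simp⟩
    simp; omega
  rw [Finset.sum_ite_eq' (farey T) (0 : ℚ) (fun _ => (1 : ℝ)), if_pos h0] at h
  rw [h]
  apply Finset.sum_congr rfl
  intro n hn
  have hn0 : 0 < n := (Finset.mem_Ioc.1 hn).1
  have : ∑ a ∈ Finset.range n, (if (a : ℚ) / n = 0 then (1 : ℝ) else 0) = 1 := by
    rw [Finset.sum_eq_single_of_mem 0 (Finset.mem_range.2 hn0)]
    · simp
    · intro b _ hb
      rw [if_neg]
      have : (n : ℚ) ≠ 0 := by exact_mod_cast hn0.ne'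
      have : (b : ℚ) ≠ 0 := by exact_mod_cast hb
      positivity
  rw [this, mul_one]

lemma F_eq (T : ℕ) : (F T : ℝ) = ∑ n ∈ Finset.Ioc 0 T, (mertens (T / n) : ℝ) * n := by
  have h := farey_sum (fun _ => 1) T
  simp only [Finset.sum_const, nsmul_eq_mul, mul_one, Finset.card_range] at h
  exact h

lemma count_eq (T : ℕ) (x : ℚ) (hx0 : 0 ≤ x) (hx1 : x ≤ 1) :
    (((farey T).filter (fun ξ => 1 - x ≤ ξ ∧ ξ ≤ 1)).card : ℝ) =
      ∑ n ∈ Finset.Ioc 0 T, (mertens (T / n) : ℝ) * (⌊(n : ℝ) * x⌋ : ℤ) := by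
  have h := farey_sum (fun ξ => if 1 - x ≤ ξ ∧ ξ ≤ 1 then 1 else 0) T
  rw [← Finset.sum_filter] at h
  simp only [Finset.sum_const, nsmul_eq_mul, mul_one] at h
  rw [h]
  apply Finset.sum_congr rfl
  intro n hn
  have hn0 : 0 < n := (Finset.mem_Ioc.1 hn).1
  have hnQ : (0 : ℚ) < n := by exact_mod_cast hn0
  congr 1
  rw [← Finset.sum_filter]
  simp only [Finset.sum_const, nsmul_eq_mul, mul_one]
  have hfl : ⌊(n : ℝ) * x⌋ = ⌊(n : ℚ) * x⌋ := by
    have : (n : ℝ) * x = (((n : ℚ) * x : ℚ) : ℝ) := by push_cast; rfl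
    rw [this, Rat.floor_cast]
  have hnn : 0 ≤ (n : ℚ) * x := by positivity
  have hnle : (n : ℚ) * x ≤ n := by nlinarith
  have hfn : ⌊(n : ℚ) * x⌋ = (⌊(n : ℚ) * x⌋₊ : ℤ) := (Int.natCast_floor_eq_floor hnn).symm
  rw [hfl, hfn]
  have hcard : ((Finset.range n).filter
      (fun a : ℕ => 1 - x ≤ (a : ℚ) / n ∧ (a : ℚ) / n ≤ 1)).card = ⌊(n : ℚ) * x⌋₊ := by
    have hF : ⌊(n : ℚ) * x⌋₊ ≤ n := by
      have := Nat.floor_mono hnle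
      simpa using this
    have : (Finset.range n).filter (fun a : ℕ => 1 - x ≤ (a : ℚ) / n ∧ (a : ℚ) / n ≤ 1) =
        Finset.Ico (n - ⌊(n : ℚ) * x⌋₊) n := by
      ext a
      simp only [Finset.mem_filter, Finset.mem_range, Finset.mem_Ico]
      constructor
      · rintro ⟨h1, h2, _⟩
        refine ⟨?_, h1⟩
        rw [le_div_iff₀ hnQ] at h2
        have : n - a ≤ ⌊(n : ℚ) * x⌋₊ := by
          apply Nat.le_floor
          rw [Nat.cast_sub h1.le]; linarith
        omega
      · rintro ⟨h1, h2⟩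
        have h3 : n - a ≤ ⌊(n : ℚ) * x⌋₊ := by omega
        have h4 := (Nat.le_floor_iff hnn).1 h3
        rw [Nat.cast_sub h2.le] at h4
        have h5 : (a : ℚ) < n := by exact_mod_cast h2
        refine ⟨h2, ?_, ?_⟩
        · rw [le_div_iff₀ hnQ]; linarith
        · rw [div_le_one hnQ]; exact h5.le
    rw [this, Nat.card_Ico]; omega
  rw [hcard]; push_cast; rfl

lemma fareyHalf_range (T : ℕ) (q : ℚ) (hq : q ∈ fareyHalf T) : 0 ≤ q ∧ q ≤ 1 / 2 := by
  unfold fareyHalf farey at hq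
  simp only [Finset.mem_filter, Finset.mem_image] at hq
  obtain ⟨⟨p, _, rfl⟩, h⟩ := hq
  exact ⟨by positivity, h⟩

lemma fareyHalf_card (T : ℕ) : ((fareyHalf T).card : ℝ) ≤ ((T : ℝ) + 1) ^ 2 := by
  have h : (fareyHalf T).card ≤ (T + 1) * (T + 1) := by
    unfold fareyHalf farey
    refine (Finset.card_filter_le _ _).trans (Finset.card_image_le.trans
      ((Finset.card_filter_le _ _).trans ?_))
    simp
  calc ((fareyHalf T).card : ℝ) ≤ ((T + 1) * (T + 1) : ℕ) := by exact_mod_cast h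
    _ = _ := by push_cast; ring

/-- The inner sums. -/
noncomputable def Ssum (T k : ℕ) : ℝ := ∑ q ∈ fareyHalf T, sawt ((k : ℝ) * (q : ℝ) ^ 2)

lemma main_identity (T : ℕ) (hT : 1 ≤ T) :
    (C T : ℝ) - F T * G T = - ∑ k ∈ Finset.Ioc 0 T, (mertens (T / k) : ℝ) * Ssum T k
      - (fareyHalf T).card / 2 := by
  have h1 : (C T : ℝ) = ∑ q ∈ fareyHalf T, ∑ n ∈ Finset.Ioc 0 T,
      (mertens (T / n) : ℝ) * (⌊(n : ℝ) * (q : ℝ) ^ 2⌋ : ℤ) := by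
    unfold C
    push_cast
    apply Finset.sum_congr rfl
    intro q hq
    obtain ⟨h0, h2⟩ := fareyHalf_range T q hq
    rw [count_eq T (q ^ 2) (by positivity) (by nlinarith)]
    push_cast
    rfl
  have h2 : (F T : ℝ) * G T = ∑ q ∈ fareyHalf T, ∑ n ∈ Finset.Ioc 0 T,
      (mertens (T / n) : ℝ) * ((n : ℝ) * (q : ℝ) ^ 2) := by
    unfold G
    rw [F_eq, Finset.mul_sum]
    apply Finset.sum_congr rfl
    intro q _
    rw [Finset.sum_mul]
    apply Finset.sum_congr rfl
    intro n _
    ring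
  have h3 : ((fareyHalf T).card : ℝ) / 2 = ∑ q ∈ fareyHalf T, ∑ n ∈ Finset.Ioc 0 T,
      (mertens (T / n) : ℝ) * (1 / 2) := by
    rw [← Finset.sum_mul, sum_mertens T hT]
    simp; ring
  unfold Ssum
  simp_rw [Finset.mul_sum]
  rw [Finset.sum_comm, h1, h2, h3, ← Finset.sum_sub_distrib, ← Finset.sum_neg_distrib,
    ← Finset.sum_sub_distrib]
  apply Finset.sum_congr rfl
  intro q _
  rw [← Finset.sum_sub_distrib, ← Finset.sum_neg_distrib, ← Finset.sum_sub_distrib]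
  apply Finset.sum_congr rfl
  intro n _
  unfold sawt Int.fract
  ring

lemma Ssum_eq (T k : ℕ) : Ssum T k = ∑ n ∈ Finset.Ioc 0 T, (mertens (T / n) : ℝ) *
    ∑ a ∈ Finset.range (n / 2 + 1), sawt ((k : ℝ) / (n : ℝ) ^ 2 * (a : ℝ) ^ 2) := by
  unfold Ssum fareyHalf
  rw [Finset.sum_filter, farey_sum (fun ξ => if ξ ≤ 1 / 2 then sawt ((k : ℝ) * (ξ : ℝ) ^ 2) else 0)]
  apply Finset.sum_congr rfl
  intro n hn
  have hn0 : 0 < n := (Finset.mem_Ioc.1 hn).1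
  have hnQ : (0 : ℚ) < n := by exact_mod_cast hn0
  congr 1
  rw [← Finset.sum_filter]
  have : (Finset.range n).filter (fun a : ℕ => (a : ℚ) / n ≤ 1 / 2) = Finset.range (n / 2 + 1) := by
    ext a
    simp only [Finset.mem_filter, Finset.mem_range]
    rw [div_le_iff₀ hnQ]
    constructor
    · rintro ⟨_, h⟩
      have : (2 * a : ℚ) ≤ n := by linarith
      have : 2 * a ≤ n := by exact_mod_cast this
      omega
    · intro h
      have h2 : 2 * a ≤ n := by omega
      have : (2 * a : ℚ) ≤ n := by exact_mod_cast h2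
      exact ⟨by omega, by linarith⟩
  rw [this]
  apply Finset.sum_congr rfl
  intro a _
  congr 1
  push_cast
  rw [div_pow]; ring

lemma mertens_triv (n : ℕ) : |(mertens n : ℝ)| ≤ n := by
  unfold mertens
  push_cast
  refine (Finset.abs_sum_le_sum_abs _ _).trans ?_
  have : ∀ k ∈ Finset.Icc 1 n, |((ArithmeticFunction.moebius k : ℤ) : ℝ)| ≤ 1 := by
    intro k _
    have := ArithmeticFunction.abs_moebius_le_one (n := k)
    exact_mod_cast this
  refine (Finset.sum_le_sum this).trans ?_
  simp

lemma mertens_div (T k : ℕ) : |(mertens (T / k) : ℝ)| ≤ T * (k : ℝ)⁻¹ := by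
  refine (mertens_triv _).trans ?_
  rw [← div_eq_mul_inv]
  exact Nat.cast_div_le

lemma sum_inv_le (T : ℕ) : ∑ k ∈ Finset.Ioc 0 T, (k : ℝ)⁻¹ ≤ 1 + Real.log T := by
  have hh := harmonic_le_one_add_log T
  rw [harmonic_eq_sum_Icc] at hh
  push_cast at hh
  exact hh

lemma W_bound (T k n : ℕ) (hT : 1 ≤ T) (hk : T < k ^ 2) (hkT : k ≤ T) (hn : 1 ≤ n) (hnT : n ≤ T)
    (U : ℝ) (hU : 1 ≤ U) (hUT : U ^ 4 = T) :
    |∑ a ∈ Finset.range (n / 2 + 1), sawt ((k : ℝ) / (n : ℝ) ^ 2 * (a : ℝ) ^ 2)| ≤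
      200 * (U ^ 3 * (1 + Real.log T)) := by
  have hTR : (1 : ℝ) ≤ T := by exact_mod_cast hT
  have hlogT : 0 ≤ Real.log T := Real.log_nonneg hTR
  have hnR : (1 : ℝ) ≤ n := by exact_mod_cast hn
  have hnTR : (n : ℝ) ≤ U ^ 4 := by rw [hUT]; exact_mod_cast hnT
  have hkTR : (k : ℝ) ≤ U ^ 4 := by rw [hUT]; exact_mod_cast hkT
  have hk1 : 1 ≤ k := by
    rcases Nat.eq_zero_or_pos k with rfl | h
    · simp at hk
    · exact h
  have hkR : (1 : ℝ) ≤ k := by exact_mod_cast hk1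
  have hkU : U ^ 2 ≤ k := by
    have : (T : ℝ) ≤ (k : ℝ) ^ 2 := by exact_mod_cast hk.le
    rw [← hUT] at this
    have h2 : (U ^ 2) ^ 2 ≤ (k : ℝ) ^ 2 := by linarith [this, (by ring : (U ^ 2) ^ 2 = U ^ 4)]
    exact le_of_sq_le_sq h2 (by linarith)
  have hNn : ((n / 2 + 1 : ℕ) : ℝ) ≤ n := by
    exact_mod_cast (by omega : n / 2 + 1 ≤ n)
  rcases le_or_gt (n : ℝ) (U ^ 3) with hsm | hbig
  · refine (Finset.abs_sum_le_sum_abs _ _).trans ?_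
    refine (Finset.sum_le_sum (fun a _ => sawt_abs_le _)).trans ?_
    rw [Finset.sum_const, Finset.card_range, nsmul_eq_mul]
    have : 0 ≤ U ^ 3 * Real.log T := by positivity
    nlinarith
  set α := (k : ℝ) / (n : ℝ) ^ 2 with hα
  have hα0 : 0 < α := by positivity
  have hα1 : α ≤ 1 := by
    rw [hα, div_le_one (by positivity)]
    have h1 : U ^ 4 ≤ U ^ 6 := pow_le_pow_right₀ hU (by norm_num)
    have h2 : (U ^ 3) ^ 2 ≤ (n : ℝ) ^ 2 := by gcongr
    have h3 : (U ^ 3) ^ 2 = U ^ 6 := by ring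
    linarith
  have hexQ : ∃ m : ℕ, 1 < α * ((m : ℝ) + 1) ^ 3 := by
    obtain ⟨m, hm⟩ := exists_nat_gt (1 / α)
    refine ⟨m, ?_⟩
    rw [div_lt_iff₀ hα0] at hm
    have hm0 : (0 : ℝ) ≤ m := by positivity
    have : (m : ℝ) ≤ ((m : ℝ) + 1) ^ 3 := by nlinarith [pow_nonneg hm0 3, pow_nonneg hm0 2]
    nlinarith
  classical
  set Q := Nat.find hexQ with hQdef
  have hQ2 : 1 < α * ((Q : ℝ) + 1) ^ 3 := Nat.find_spec hexQ
  have hQ1 : 1 ≤ Q := by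
    by_contra h
    have h0 : Q = 0 := by omega
    rw [h0] at hQ2
    norm_num at hQ2
    linarith
  have hQ3 : α * (Q : ℝ) ^ 3 ≤ 1 := by
    have := Nat.find_min hexQ (m := Q - 1) (by omega)
    push Not at this
    rw [Nat.cast_sub hQ1] at this
    simpa using this
  have hQR : (1 : ℝ) ≤ Q := by exact_mod_cast hQ1
  have hD := disc_bound α hα0 Q hQ1 hQ3 hQ2.le (n / 2 + 1)
  refine hD.trans ?_
  have hQT : (Q : ℝ) ≤ T := by
    have h1 : (Q : ℝ) ^ 3 ≤ (n : ℝ) ^ 2 := by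
      rw [hα, div_mul_eq_mul_div, div_le_one (by positivity)] at hQ3
      have : 0 ≤ (Q : ℝ) ^ 3 := by positivity
      nlinarith
    have h2 : (n : ℝ) ^ 2 ≤ (T : ℝ) ^ 3 := by
      have : (n : ℝ) ^ 2 ≤ (T : ℝ) ^ 2 := by
        rw [hUT] at hnTR; gcongr
      exact this.trans (pow_le_pow_right₀ hTR (by norm_num))
    exact le_of_pow_le_pow_left₀ (by norm_num) (by positivity) (h1.trans h2)
  have hlog : Real.log Q ≤ Real.log T := Real.log_le_log (by linarith) hQT
  have hlogQ : 0 ≤ Real.log Q := Real.log_nonneg hQR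
  have hnQ : (n : ℝ) / Q ≤ 2 * U ^ 3 := by
    have h1 : ((n : ℝ) / Q) ^ 3 ≤ (2 * U ^ 3) ^ 3 := by
      rw [div_pow, div_le_iff₀ (by positivity)]
      have h8 : ((Q : ℝ) + 1) ^ 3 ≤ (2 * Q) ^ 3 := by gcongr; linarith
      have h9 : (n : ℝ) ^ 2 ≤ k * (2 * Q) ^ 3 := by
        rw [hα, div_mul_eq_mul_div, lt_div_iff₀ (by positivity), one_mul] at hQ2
        refine hQ2.le.trans ?_
        gcongr
      have h10 : U ^ 8 ≤ U ^ 9 := pow_le_pow_right₀ hU (by norm_num)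
      calc (n : ℝ) ^ 3 = n * (n : ℝ) ^ 2 := by ring
        _ ≤ U ^ 4 * (k * (2 * Q) ^ 3) := by gcongr
        _ ≤ U ^ 4 * (U ^ 4 * (2 * Q) ^ 3) := by gcongr
        _ = 8 * U ^ 8 * (Q : ℝ) ^ 3 := by ring
        _ ≤ 8 * U ^ 9 * (Q : ℝ) ^ 3 := by gcongr
        _ = _ := by ring
    exact le_of_pow_le_pow_left₀ (by norm_num) (by positivity) h1
  have hsq : 1 / Real.sqrt α ≤ U ^ 3 := by
    have h1 : U / n ≤ Real.sqrt α := by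
      apply Real.le_sqrt_of_sq_le
      rw [hα, div_pow]; gcongr
    rw [div_le_iff₀ (Real.sqrt_pos.2 hα0)]
    have h2 : 1 ≤ U ^ 3 * (U / n) := by
      rw [← mul_div_assoc, le_div_iff₀ (by linarith)]
      linarith [(by ring : U ^ 3 * U = U ^ 4)]
    refine h2.trans ?_
    gcongr
  have t1 : ((n / 2 + 1 : ℕ) : ℝ) * (1 + Real.log Q) / Q ≤ 2 * U ^ 3 * (1 + Real.log T) := by
    calc ((n / 2 + 1 : ℕ) : ℝ) * (1 + Real.log Q) / Q ≤ n * (1 + Real.log T) / Q := by gcongr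
      _ = n / Q * (1 + Real.log T) := by ring
      _ ≤ _ := by gcongr
  have : 0 ≤ U ^ 3 * Real.log T := by positivity
  nlinarith

lemma Ssum_bound (T k : ℕ) (hT : 1 ≤ T) (hk : T < k ^ 2) (hkT : k ≤ T)
    (U : ℝ) (hU : 1 ≤ U) (hUT : U ^ 4 = T) :
    |Ssum T k| ≤ 200 * (T * U ^ 3 * (1 + Real.log T) ^ 2) := by
  have hTR : (1 : ℝ) ≤ T := by exact_mod_cast hT
  have hlogT : 0 ≤ Real.log T := Real.log_nonneg hTR
  rw [Ssum_eq]
  refine (Finset.abs_sum_le_sum_abs _ _).trans ?_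
  have : ∀ n ∈ Finset.Ioc 0 T, |(mertens (T / n) : ℝ) *
    ∑ a ∈ Finset.range (n / 2 + 1), sawt ((k : ℝ) / (n : ℝ) ^ 2 * (a : ℝ) ^ 2)| ≤
      (n : ℝ)⁻¹ * (T * (200 * (U ^ 3 * (1 + Real.log T)))) := by
    intro n hn
    obtain ⟨h1, h2⟩ := Finset.mem_Ioc.1 hn
    rw [abs_mul]
    calc _ ≤ (T * (n : ℝ)⁻¹) * (200 * (U ^ 3 * (1 + Real.log T))) := by
          gcongr
          · exact mertens_div T n
          · exact W_bound T k n hT hk hkT h1 h2 U hU hUT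
      _ = _ := by ring
  refine (Finset.sum_le_sum this).trans ?_
  rw [← Finset.sum_mul]
  calc _ ≤ (1 + Real.log T) * (T * (200 * (U ^ 3 * (1 + Real.log T)))) := by
        gcongr
        exact sum_inv_le T
    _ = _ := by ring

lemma Ssum_triv (T k : ℕ) (hT : 1 ≤ T) : |Ssum T k| ≤ 2 * (T : ℝ) ^ 2 := by
  have hTR : (1 : ℝ) ≤ T := by exact_mod_cast hT
  unfold Ssum
  refine (Finset.abs_sum_le_sum_abs _ _).trans ?_
  refine (Finset.sum_le_sum (fun a _ => sawt_abs_le _)).trans ?_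
  rw [Finset.sum_const, nsmul_eq_mul]
  have := fareyHalf_card T
  nlinarith

/-- Powers of logarithms are absorbed. -/
lemma log_absorb (ε : ℝ) (hε : 0 < ε) : ∃ K : ℝ, 0 < K ∧ ∀ T : ℕ, 1 ≤ T →
    (1 + Real.log T) ^ 3 ≤ K * (T : ℝ) ^ ε := by
  refine ⟨(1 + 3 / ε) ^ 3, by positivity, ?_⟩
  intro T hT
  have hTR : (1 : ℝ) ≤ T := by exact_mod_cast hT
  have hlogT : 0 ≤ Real.log T := Real.log_nonneg hTR
  have h1 := Real.log_natCast_le_rpow_div T (ε := ε / 3) (by positivity)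
  have h2 : 1 ≤ (T : ℝ) ^ (ε / 3) := Real.one_le_rpow hTR (by positivity)
  have h3 : 1 + Real.log T ≤ (1 + 3 / ε) * (T : ℝ) ^ (ε / 3) := by
    have : (T : ℝ) ^ (ε / 3) / (ε / 3) = 3 / ε * (T : ℝ) ^ (ε / 3) := by field_simp
    rw [this] at h1
    linarith
  calc (1 + Real.log T) ^ 3 ≤ ((1 + 3 / ε) * (T : ℝ) ^ (ε / 3)) ^ 3 := by gcongr
    _ = (1 + 3 / ε) ^ 3 * ((T : ℝ) ^ (ε / 3)) ^ 3 := by ring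
    _ = _ := by
      rw [← Real.rpow_natCast ((T : ℝ) ^ (ε / 3)) 3, ← Real.rpow_mul (by positivity)]
      congr 2
      push_cast; ring

theorem mainTerm_FG (δ : ℝ → ℝ)
    (hδpos : ∀ t : ℝ, 1 ≤ t → 0 < δ t)
    (hδanti : AntitoneOn δ (Set.Ici (1 : ℝ)))
    (hδM : ∀ t : ℝ, 1 ≤ t → |(mertens ⌊t⌋₊ : ℝ)| ≤ t * δ t) :
    ∀ ε : ℝ, 0 < ε → ∃ K : ℝ, 0 < K ∧ ∀ T : ℕ, 3 ≤ T →
      |(C T : ℝ) - (F T : ℝ) * G T| ≤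
        K * ((T : ℝ) ^ ((11 : ℝ) / 4 + ε)
          + (T : ℝ) ^ 3 * δ (Real.sqrt T) * Real.log T) := by
  intro ε hε
  obtain ⟨K, hK, hlogK⟩ := log_absorb ε hε
  refine ⟨200 * K + 10, by positivity, ?_⟩
  intro T hT
  have hT1 : 1 ≤ T := by omega
  have hTR : (3 : ℝ) ≤ T := by exact_mod_cast hT
  have hlog1 : 1 ≤ Real.log T := by
    rw [Real.le_log_iff_exp_le (by linarith)]
    have := Real.exp_one_lt_d9
    linarith
  set U := Real.sqrt (Real.sqrt T) with hUdef
  have hs1 : 1 ≤ Real.sqrt T := Real.one_le_sqrt.2 (by linarith)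
  have hU : 1 ≤ U := Real.one_le_sqrt.2 hs1
  have hU2 : U ^ 2 = Real.sqrt T := Real.sq_sqrt (by positivity)
  have hUT : U ^ 4 = T := by
    have : U ^ 4 = (U ^ 2) ^ 2 := by ring
    rw [this, hU2, Real.sq_sqrt (by positivity)]
  have hδ0 : 0 < δ (Real.sqrt T) := hδpos _ hs1
  set D := δ (Real.sqrt T) with hD
  have hterm : ∀ k ∈ Finset.Ioc 0 T, |(mertens (T / k) : ℝ) * Ssum T k| ≤
      (k : ℝ)⁻¹ * (2 * (T : ℝ) ^ 3 * D + 200 * ((T : ℝ) ^ 2 * U ^ 3 * (1 + Real.log T) ^ 2)) := by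
    intro k hk
    obtain ⟨hk0, hkT⟩ := Finset.mem_Ioc.1 hk
    have hkR : (0 : ℝ) < k := by exact_mod_cast hk0
    rw [abs_mul]
    rcases le_or_gt (k ^ 2) T with h | h
    · have hkR2 : (k : ℝ) ^ 2 ≤ T := by exact_mod_cast h
      have hks : (k : ℝ) ≤ Real.sqrt T := Real.le_sqrt_of_sq_le hkR2
      have hst : Real.sqrt T ≤ (T : ℝ) / k := by
        rw [le_div_iff₀ hkR]
        have := Real.mul_self_sqrt (by positivity : (0 : ℝ) ≤ T)
        nlinarith
      have h1 := hδM ((T : ℝ) / k) (hs1.trans hst)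
      rw [Nat.floor_div_eq_div] at h1
      have h2 : δ ((T : ℝ) / k) ≤ D :=
        hδanti (Set.mem_Ici.2 hs1) (Set.mem_Ici.2 (hs1.trans hst)) hst
      calc _ ≤ ((T : ℝ) / k * D) * (2 * (T : ℝ) ^ 2) := by
            gcongr
            · refine h1.trans ?_
              gcongr
            · exact Ssum_triv T k hT1
        _ = (k : ℝ)⁻¹ * (2 * (T : ℝ) ^ 3 * D) := by ring
        _ ≤ _ := by
          gcongr
          have : 0 ≤ 200 * ((T : ℝ) ^ 2 * U ^ 3 * (1 + Real.log T) ^ 2) := by positivity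
          linarith
    · calc _ ≤ (T * (k : ℝ)⁻¹) * (200 * (T * U ^ 3 * (1 + Real.log T) ^ 2)) := by
            gcongr
            · exact mertens_div T k
            · exact Ssum_bound T k hT1 h hkT U hU hUT
        _ = (k : ℝ)⁻¹ * (200 * ((T : ℝ) ^ 2 * U ^ 3 * (1 + Real.log T) ^ 2)) := by ring
        _ ≤ _ := by
          gcongr
          have : 0 ≤ 2 * (T : ℝ) ^ 3 * D := by positivity
          linarith
  have hsum : |∑ k ∈ Finset.Ioc 0 T, (mertens (T / k) : ℝ) * Ssum T k| ≤
      (1 + Real.log T) *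
        (2 * (T : ℝ) ^ 3 * D + 200 * ((T : ℝ) ^ 2 * U ^ 3 * (1 + Real.log T) ^ 2)) := by
    refine (Finset.abs_sum_le_sum_abs _ _).trans ((Finset.sum_le_sum hterm).trans ?_)
    rw [← Finset.sum_mul]
    gcongr
    exact sum_inv_le T
  have hpow : (T : ℝ) ^ 2 * U ^ 3 = (T : ℝ) ^ ((11 : ℝ) / 4) := by
    have : (T : ℝ) ^ ((1 : ℝ) / 4) = U := by
      rw [← hUT, ← Real.rpow_natCast, ← Real.rpow_mul (by positivity)]
      norm_num
    rw [← this, ← Real.rpow_natCast, ← Real.rpow_natCast, ← Real.rpow_mul (by positivity),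
      ← Real.rpow_add (by positivity)]
    norm_num
  have hpow2 : (T : ℝ) ^ ((11 : ℝ) / 4 + ε) = (T : ℝ) ^ 2 * U ^ 3 * (T : ℝ) ^ ε := by
    rw [hpow, Real.rpow_add (by positivity)]
  rw [main_identity T hT1, hpow2]
  have hcard := fareyHalf_card T
  have hcard0 : (0 : ℝ) ≤ (fareyHalf T).card := by positivity
  have habs : |(- ∑ k ∈ Finset.Ioc 0 T, (mertens (T / k) : ℝ) * Ssum T k
      - (fareyHalf T).card / 2)| ≤ |∑ k ∈ Finset.Ioc 0 T, (mertens (T / k) : ℝ) * Ssum T k|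
      + (fareyHalf T).card / 2 := by
    have := abs_sub (- ∑ k ∈ Finset.Ioc 0 T, (mertens (T / k) : ℝ) * Ssum T k)
      ((fareyHalf T).card / 2 : ℝ)
    rwa [abs_neg, abs_of_nonneg (by positivity : (0 : ℝ) ≤ (fareyHalf T).card / 2)] at this
  refine habs.trans ?_
  have hTe : 1 ≤ (T : ℝ) ^ ε := Real.one_le_rpow (by linarith) hε.le
  have hU3 : 1 ≤ U ^ 3 := one_le_pow₀ hU
  have b1 : ((fareyHalf T).card : ℝ) / 2 ≤ 2 * ((T : ℝ) ^ 2 * U ^ 3 * (T : ℝ) ^ ε) := by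
    have h1 : (T : ℝ) ^ 2 ≤ (T : ℝ) ^ 2 * U ^ 3 * (T : ℝ) ^ ε := by
      rw [mul_assoc]
      apply le_mul_of_one_le_right (by positivity)
      nlinarith
    nlinarith
  have b2 : (T : ℝ) ^ 2 * U ^ 3 * (1 + Real.log T) ^ 3 ≤
      (T : ℝ) ^ 2 * U ^ 3 * (K * (T : ℝ) ^ ε) := by
    gcongr
    exact hlogK T hT1
  have b3 : (1 + Real.log T) * (2 * (T : ℝ) ^ 3 * D) ≤ 4 * ((T : ℝ) ^ 3 * D * Real.log T) := by
    have : 0 ≤ (T : ℝ) ^ 3 * D := by positivity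
    nlinarith
  have p1 : 0 ≤ (T : ℝ) ^ 2 * U ^ 3 * (T : ℝ) ^ ε := by positivity
  have p2 : 0 ≤ (T : ℝ) ^ 3 * D * Real.log T := by positivity
  have p3 : 0 ≤ K * ((T : ℝ) ^ 3 * D * Real.log T) := by positivity
  calc _ ≤ (1 + Real.log T) *
        (2 * (T : ℝ) ^ 3 * D + 200 * ((T : ℝ) ^ 2 * U ^ 3 * (1 + Real.log T) ^ 2))
        + 2 * ((T : ℝ) ^ 2 * U ^ 3 * (T : ℝ) ^ ε) := add_le_add hsum b1
    _ = (1 + Real.log T) * (2 * (T : ℝ) ^ 3 * D)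
        + 200 * ((T : ℝ) ^ 2 * U ^ 3 * (1 + Real.log T) ^ 3)
        + 2 * ((T : ℝ) ^ 2 * U ^ 3 * (T : ℝ) ^ ε) := by ring
    _ ≤ 4 * ((T : ℝ) ^ 3 * D * Real.log T)
        + 200 * ((T : ℝ) ^ 2 * U ^ 3 * (K * (T : ℝ) ^ ε))
        + 2 * ((T : ℝ) ^ 2 * U ^ 3 * (T : ℝ) ^ ε) := by linarith
    _ ≤ _ := by nlinarith
end

section
/- (Gupta's lemma.) For any integers m ≥ 1 and T ≥ 1, with ℓ = ⌊log T / log 2⌋, one has ∑_{1 ≤ d ≤ T, gcd(d,m)=1} μ(d)·⌊T/d⌋ = #{d : d ∣ m^ℓ and d ≤ T}, where μ is the Möbius function. -/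
lemma gupta_decomp (m : ℕ) (n : ℕ) : 1 ≤ n → ∃ a b k : ℕ, n = a * b ∧ Nat.Coprime b m ∧
    a ∣ m ^ k ∧ 2 ^ k ≤ a := by
  induction n using Nat.strong_induction_on with
  | _ n ih =>
    intro hn
    by_cases h : Nat.Coprime n m
    · exact ⟨1, n, 0, by simp, h, by simp, by simp⟩
    · obtain ⟨p, hp, hpn, hpm⟩ := Nat.Prime.not_coprime_iff_dvd.mp h
      obtain ⟨n', rfl⟩ := hpn
      have h2 := hp.two_le
      have hn' : 1 ≤ n' := by
        rcases Nat.eq_zero_or_pos n' with h0 | h0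
        · simp [h0] at hn
        · exact h0
      obtain ⟨a, b, k, h1, hb, ha, hk⟩ := ih n' (by nlinarith) hn'
      refine ⟨p * a, b, k + 1, by rw [h1, mul_assoc], hb, ?_, ?_⟩
      · rw [pow_succ']; exact mul_dvd_mul hpm ha
      · rw [pow_succ']; exact Nat.mul_le_mul h2 hk

lemma gupta_inner (m T n : ℕ) (hn : 1 ≤ n) (hnT : n ≤ T) :
    ∑ d ∈ n.divisors.filter (fun d => Nat.gcd d m = 1), ArithmeticFunction.moebius d
      = if n ∣ m ^ Nat.log 2 T then 1 else 0 := by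
  obtain ⟨a, b, k, h1, hb, ha, hk⟩ := gupta_decomp m n hn
  have hapos : 0 < a := lt_of_lt_of_le (by positivity) hk
  have hbpos : 0 < b := by
    rcases Nat.eq_zero_or_pos b with h0 | h0
    · simp [h1, h0] at hn
    · exact h0
  have hs : n.divisors.filter (fun d => Nat.gcd d m = 1) = b.divisors := by
    ext d
    simp only [Finset.mem_filter, Nat.mem_divisors]
    constructor
    · rintro ⟨⟨hd, _⟩, hc⟩
      refine ⟨?_, hbpos.ne'⟩
      have : Nat.Coprime d a := Nat.Coprime.coprime_dvd_right ha (Nat.Coprime.pow_right k hc)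
      rw [h1] at hd
      exact this.dvd_of_dvd_mul_left hd
    · rintro ⟨hd, _⟩
      exact ⟨⟨h1 ▸ Dvd.dvd.mul_left hd a, by omega⟩, Nat.Coprime.coprime_dvd_left hd hb⟩
  rw [hs, ← ArithmeticFunction.coe_mul_zeta_apply, ArithmeticFunction.moebius_mul_coe_zeta,
    ArithmeticFunction.one_apply]
  refine if_congr ?_ rfl rfl
  constructor
  · rintro rfl
    have hna : n = a := by simpa using h1
    have : k ≤ Nat.log 2 T := Nat.le_log_of_pow_le (by norm_num) (by omega)
    rw [hna]
    exact ha.trans (pow_dvd_pow m this)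
  · intro h
    have h3 : b ∣ m ^ Nat.log 2 T := (Dvd.intro_left a h1.symm).trans h
    exact Nat.Coprime.eq_one_of_dvd (Nat.Coprime.pow_right _ hb) h3

/-- Gupta's lemma: for integers `m, T ≥ 1` and `ℓ = ⌊log T / log 2⌋`,
`∑_{1 ≤ d ≤ T, gcd(d,m)=1} μ(d)·⌊T/d⌋` equals the number of divisors of `m^ℓ`
that are at most `T`. -/
theorem gupta (m T : ℕ) (hm : 1 ≤ m) (hT : 1 ≤ T) :
    ∑ d ∈ (Finset.Icc 1 T).filter (fun d => Nat.gcd d m = 1),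
        ArithmeticFunction.moebius d * ((T / d : ℕ) : ℤ)
      = ((((m ^ ⌊Real.log T / Real.log 2⌋₊).divisors).filter (fun d => d ≤ T)).card : ℤ) := by
  have hfl : ⌊Real.log T / Real.log 2⌋₊ = Nat.log 2 T := by
    have := Real.natFloor_logb_natCast 2 T
    simpa [Real.logb] using this
  rw [hfl]
  have hset : ((m ^ Nat.log 2 T).divisors).filter (fun d => d ≤ T)
      = (Finset.Icc 1 T).filter (fun n => n ∣ m ^ Nat.log 2 T) := by
    ext d
    simp only [Finset.mem_filter, Nat.mem_divisors, Finset.mem_Icc]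
    have hp : 0 < m ^ Nat.log 2 T := by positivity
    constructor
    · rintro ⟨⟨h, _⟩, h'⟩
      exact ⟨⟨Nat.pos_of_dvd_of_pos h hp, h'⟩, h⟩
    · rintro ⟨⟨_, h'⟩, h⟩
      exact ⟨⟨h, hp.ne'⟩, h'⟩
  rw [hset, Finset.card_filter]
  push_cast
  have hR : ∀ n ∈ Finset.Icc 1 T, (if n ∣ m ^ Nat.log 2 T then (1 : ℤ) else 0)
      = ∑ d ∈ (Finset.Icc 1 T).filter (fun d => Nat.gcd d m = 1),
        if d ∣ n then ArithmeticFunction.moebius d else 0 := by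
    intro n hn
    rw [Finset.mem_Icc] at hn
    rw [← gupta_inner m T n hn.1 hn.2, ← Finset.sum_filter]
    refine Finset.sum_congr ?_ fun _ _ => rfl
    ext d
    simp only [Finset.mem_filter, Nat.mem_divisors, Finset.mem_Icc]
    constructor
    · rintro ⟨⟨h, _⟩, h'⟩
      exact ⟨⟨⟨Nat.pos_of_dvd_of_pos h hn.1, (Nat.le_of_dvd hn.1 h).trans hn.2⟩, h'⟩, h⟩
    · rintro ⟨⟨_, h'⟩, h⟩
      exact ⟨⟨h, by omega⟩, h'⟩
  rw [Finset.sum_congr rfl hR, Finset.sum_comm]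
  refine Finset.sum_congr rfl fun d _ => ?_
  rw [← Finset.sum_filter, Finset.sum_const, nsmul_eq_mul, mul_comm]
  have : (Finset.Icc 1 T).filter (fun n => d ∣ n) = (Finset.Ioc 0 T).filter (fun n => d ∣ n) := by
    rfl
  rw [this, Nat.Ioc_filter_dvd_card_eq_div]
  push_cast
  rfl
end

section
/- (Niederreiter's discrepancy bound for Farey fractions.) There is a constant K > 0 such that for every integer T ≥ 1 and every real α with 0 ≤ α ≤ 1, |#(𝓕(T) ∩ [0,α]) − α·F(T)| ≤ K·F(T)/T. -/
open Finset in
theorem fd_mu_ind (N k : ℕ) (hk : 0 < k) (hN : k ≤ N) :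
    ∑ d ∈ Ioc 0 N, (if d ∣ k then (ArithmeticFunction.moebius d : ℝ) else 0)
      = if k = 1 then 1 else 0 := by
  have h1 : (Ioc 0 N).filter (fun d => d ∣ k) = k.divisors := by
    ext d
    simp only [mem_filter, mem_Ioc, Nat.mem_divisors]
    constructor
    · rintro ⟨_, h⟩; exact ⟨h, hk.ne'⟩
    · rintro ⟨h, _⟩
      exact ⟨⟨Nat.pos_of_dvd_of_pos h hk, (Nat.le_of_dvd hk h).trans hN⟩, h⟩
  rw [← sum_filter, h1]
  have h2 := congrArg (fun f => f k) ArithmeticFunction.coe_zeta_mul_moebius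
  simp only [ArithmeticFunction.coe_zeta_mul_apply, ArithmeticFunction.one_apply] at h2
  exact_mod_cast congrArg (fun z : ℤ => (z : ℝ)) h2

open Finset in
theorem fd_sum_mult (N d : ℕ) (hd : 0 < d) (f : ℕ → ℝ) :
    ∑ b ∈ Ioc 0 N, (if d ∣ b then f b else 0) = ∑ b ∈ Ioc 0 (N / d), f (d * b) := by
  rw [← sum_filter]
  symm
  apply sum_bij (fun b _ => d * b)
  · intro b hb
    simp only [mem_filter, mem_Ioc] at hb ⊢
    refine ⟨⟨Nat.mul_pos hd hb.1, ?_⟩, dvd_mul_right _ _⟩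
    rw [mul_comm]
    exact (Nat.le_div_iff_mul_le hd).1 hb.2
  · intro a _ b _ h
    exact Nat.eq_of_mul_eq_mul_left hd h
  · intro b hb
    simp only [mem_filter, mem_Ioc] at hb
    obtain ⟨⟨h1, h2⟩, c, rfl⟩ := hb
    refine ⟨c, ?_, rfl⟩
    simp only [mem_Ioc]
    refine ⟨Nat.pos_of_mul_pos_left h1, ?_⟩
    rw [Nat.le_div_iff_mul_le hd, mul_comm]
    exact h2
  · intros; rfl

open Finset in
theorem fd_mu_floor (N M : ℕ) (h : M ≤ N) :
    ∑ d ∈ Ioc 0 N, (ArithmeticFunction.moebius d : ℝ) * ((M / d : ℕ) : ℝ)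
      = if 1 ≤ M then 1 else 0 := by
  have h1 : ∀ d ∈ Ioc 0 N, (ArithmeticFunction.moebius d : ℝ) * ((M / d : ℕ) : ℝ)
      = ∑ k ∈ Ioc 0 M, if d ∣ k then (ArithmeticFunction.moebius d : ℝ) else 0 := by
    intro d hd
    rw [fd_sum_mult M d (mem_Ioc.1 hd).1 (fun _ => (ArithmeticFunction.moebius d : ℝ))]
    simp [mul_comm]
  rw [sum_congr rfl h1, sum_comm]
  have h2 : ∀ k ∈ Ioc 0 M, ∑ d ∈ Ioc 0 N,
      (if d ∣ k then (ArithmeticFunction.moebius d : ℝ) else 0) = if k = 1 then 1 else 0 := by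
    intro k hk
    rw [mem_Ioc] at hk
    exact fd_mu_ind N k hk.1 (hk.2.trans h)
  rw [sum_congr rfl h2, sum_ite_eq']
  simp [Nat.one_le_iff_ne_zero]

/-- Primitive lattice points in the triangle. -/
noncomputable def fdP (N : ℕ) (x : ℝ) : ℝ :=
  ∑ b ∈ Finset.Ioc 0 N, ∑ a ∈ Finset.Ioc 0 ⌊x * b⌋₊, if Nat.Coprime a b then (1 : ℝ) else 0

/-- Error term. -/
noncomputable def fdE (N : ℕ) (x : ℝ) : ℝ :=
  ∑ d ∈ Finset.Ioc 0 N, (ArithmeticFunction.moebius d : ℝ) *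
    ∑ b ∈ Finset.Ioc 0 (N / d), ((⌊x * b⌋₊ : ℝ) - x * b)

open Finset in
theorem fdP_eq (N : ℕ) (x : ℝ) :
    fdP N x = ∑ d ∈ Ioc 0 N, (ArithmeticFunction.moebius d : ℝ) *
      ∑ b ∈ Ioc 0 (N / d), (⌊x * b⌋₊ : ℝ) := by
  unfold fdP
  have h1 : ∀ b ∈ Ioc 0 N, ∑ a ∈ Ioc 0 ⌊x * b⌋₊, (if Nat.Coprime a b then (1 : ℝ) else 0)
      = ∑ d ∈ Ioc 0 N, if d ∣ b then
          (ArithmeticFunction.moebius d : ℝ) * ((⌊x * b⌋₊ / d : ℕ) : ℝ) else 0 := by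
    intro b hb
    rw [mem_Ioc] at hb
    have h2 : ∀ a ∈ Ioc 0 ⌊x * b⌋₊, (if Nat.Coprime a b then (1 : ℝ) else 0)
        = ∑ d ∈ Ioc 0 N, if d ∣ b then
          (if d ∣ a then (ArithmeticFunction.moebius d : ℝ) else 0) else 0 := by
      intro a ha
      have hg : 0 < Nat.gcd a b := Nat.gcd_pos_of_pos_right _ hb.1
      have := fd_mu_ind N (Nat.gcd a b) hg ((Nat.gcd_le_right _ hb.1).trans hb.2)
      simp only [Nat.coprime_iff_gcd_eq_one]
      rw [← this]
      apply sum_congr rfl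
      intro d _
      by_cases h3 : d ∣ a <;> by_cases h4 : d ∣ b <;> simp [Nat.dvd_gcd_iff, h3, h4]
    rw [sum_congr rfl h2, sum_comm]
    apply sum_congr rfl
    intro d hd
    split_ifs with h
    · rw [fd_sum_mult _ d (mem_Ioc.1 hd).1 (fun _ => (ArithmeticFunction.moebius d : ℝ))]
      simp [mul_comm]
    · simp
  rw [sum_congr rfl h1, sum_comm]
  apply sum_congr rfl
  intro d hd
  have hd0 := (mem_Ioc.1 hd).1
  rw [fd_sum_mult N d hd0
    (fun b => (ArithmeticFunction.moebius d : ℝ) * ((⌊x * b⌋₊ / d : ℕ) : ℝ)), mul_sum]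
  apply sum_congr rfl
  intro b _
  rw [← Nat.floor_div_natCast]
  congr 4
  push_cast
  have : (d : ℝ) ≠ 0 := by positivity
  field_simp

open Finset in
theorem fdP_sub (N : ℕ) (x : ℝ) : fdP N x - x * fdP N 1 = fdE N x := by
  rw [fdP_eq, fdP_eq, fdE, mul_sum, ← sum_sub_distrib]
  apply sum_congr rfl
  intro d _
  rw [sum_sub_distrib, ← mul_sum]
  simp only [one_mul, Nat.floor_natCast]
  ring

open Finset in
theorem fd_floor_sum (n : ℕ) (x : ℝ) (h0 : 0 ≤ x) (h : x < n + 1) :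
    (⌊x⌋₊ : ℝ) = ∑ a ∈ Ioc 0 n, if (a : ℝ) ≤ x then (1 : ℝ) else 0 := by
  have : (Ioc 0 n).filter (fun a : ℕ => (a : ℝ) ≤ x) = Ioc 0 ⌊x⌋₊ := by
    ext a
    simp only [mem_filter, mem_Ioc, Nat.le_floor_iff h0]
    constructor
    · rintro ⟨h1, h2⟩; exact ⟨h1.1, h2⟩
    · rintro ⟨h1, h2⟩
      refine ⟨⟨h1, ?_⟩, h2⟩
      have : (a : ℝ) < n + 1 := h2.trans_lt h
      exact Nat.lt_succ_iff.1 (by exact_mod_cast this)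
  rw [← sum_filter, this]
  simp

open Finset in
theorem fd_recip (x : ℝ) (hx : 0 < x) (m n : ℕ) (h1 : x * m < n + 1) (h2 : n < x * (m + 1)) :
    ∑ b ∈ Ioc 0 m, (⌊x * b⌋₊ : ℝ) + ∑ a ∈ Ioc 0 n, (⌊x⁻¹ * a⌋₊ : ℝ)
      = m * n + ∑ b ∈ Ioc 0 m, ∑ a ∈ Ioc 0 n, if (a : ℝ) = x * b then (1 : ℝ) else 0 := by
  have e1 : ∀ b ∈ Ioc 0 m, (⌊x * b⌋₊ : ℝ)
      = ∑ a ∈ Ioc 0 n, if (a : ℝ) ≤ x * b then (1 : ℝ) else 0 := by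
    intro b hb
    apply fd_floor_sum _ _ (by positivity)
    refine lt_of_le_of_lt ?_ h1
    have : (b : ℝ) ≤ m := by exact_mod_cast (mem_Ioc.1 hb).2
    gcongr
  have e2 : ∀ a ∈ Ioc 0 n, (⌊x⁻¹ * a⌋₊ : ℝ)
      = ∑ b ∈ Ioc 0 m, if (b : ℝ) ≤ x⁻¹ * a then (1 : ℝ) else 0 := by
    intro a ha
    apply fd_floor_sum _ _ (by positivity)
    rw [inv_mul_lt_iff₀ hx]
    refine lt_of_le_of_lt ?_ h2
    exact_mod_cast (mem_Ioc.1 ha).2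
  rw [sum_congr rfl e1, sum_congr rfl e2, sum_comm (s := Ioc 0 n), ← sum_add_distrib]
  have e3 : (m : ℝ) * n = ∑ b ∈ Ioc 0 m, ∑ a ∈ Ioc 0 n, (1 : ℝ) := by simp
  rw [e3, ← sum_add_distrib]
  apply sum_congr rfl
  intro b _
  rw [← sum_add_distrib, ← sum_add_distrib]
  apply sum_congr rfl
  intro a _
  simp only [le_inv_mul_iff₀ hx]
  rcases lt_trichotomy (a : ℝ) (x * b) with h | h | h
  · simp [h.le, h.not_ge, h.ne]
  · simp [h]
  · simp [h.le, h.not_ge, h.ne']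

theorem fd_den (x : ℝ) (hx : 0 < x) :
    ∃ q : ℕ, ∀ b : ℕ, (∃ a : ℕ, (a : ℝ) = x * b) ↔ q ∣ b := by
  by_cases hr : ∃ r : ℚ, (r : ℝ) = x
  · obtain ⟨r, rfl⟩ := hr
    have hr0 : 0 < r := by exact_mod_cast hx
    have hnum : 0 < r.num := Rat.num_pos.2 hr0
    obtain ⟨p, hp⟩ := Int.eq_ofNat_of_zero_le hnum.le
    have hq : (r.den : ℝ) ≠ 0 := by exact_mod_cast r.den_nz
    have hrr : (r : ℝ) = p / r.den := by
      rw [Rat.cast_def, hp]; simp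
    have hcop : Nat.Coprime r.den p := by
      have := r.reduced
      rw [hp] at this
      simpa using this.symm
    refine ⟨r.den, fun b => ⟨?_, ?_⟩⟩
    · rintro ⟨a, ha⟩
      rw [hrr] at ha
      field_simp at ha
      have : a * r.den = p * b := by
        have h : (a : ℝ) * r.den = p * b := by linarith
        exact_mod_cast h
      exact hcop.dvd_of_dvd_mul_left (this ▸ dvd_mul_left _ _)
    · rintro ⟨c, rfl⟩
      refine ⟨p * c, ?_⟩
      rw [hrr]
      push_cast
      field_simp
  · refine ⟨0, fun b => ⟨?_, ?_⟩⟩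
    · rintro ⟨a, ha⟩
      rw [zero_dvd_iff]
      by_contra hb
      have hb' : (b : ℝ) ≠ 0 := by exact_mod_cast hb
      apply hr
      refine ⟨(a : ℚ) / b, ?_⟩
      push_cast
      rw [ha]
      field_simp
    · intro h
      rw [zero_dvd_iff] at h
      subst h
      exact ⟨0, by simp⟩

open Finset in
theorem fd_diag (x : ℝ) (hx : 0 < x) : ∃ q : ℕ, ∀ m n : ℕ, x * m < n + 1 →
    ∑ b ∈ Ioc 0 m, ∑ a ∈ Ioc 0 n, (if (a : ℝ) = x * b then (1 : ℝ) else 0)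
      = ((m / q : ℕ) : ℝ) := by
  obtain ⟨q, hq⟩ := fd_den x hx
  refine ⟨q, fun m n h => ?_⟩
  rw [← Nat.Ioc_filter_dvd_card_eq_div, card_eq_sum_ones, sum_filter]
  push_cast
  apply sum_congr rfl
  intro b hb
  rw [mem_Ioc] at hb
  split_ifs with hd
  · obtain ⟨a, ha⟩ := (hq b).2 hd
    rw [sum_eq_single a]
    · simp [ha]
    · intro c _ hc
      rw [if_neg]
      intro h'
      exact hc (by exact_mod_cast h'.trans ha.symm)
    · intro hn
      exfalso
      apply hn
      rw [mem_Ioc]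
      have hb0 : (0 : ℝ) < b := by exact_mod_cast hb.1
      have hbm : (b : ℝ) ≤ m := by exact_mod_cast hb.2
      constructor
      · have : (0 : ℝ) < a := by rw [ha]; positivity
        exact_mod_cast this
      · have : (a : ℝ) < n + 1 := by
          rw [ha]
          exact lt_of_le_of_lt (by gcongr) h
        exact Nat.lt_succ_iff.1 (by exact_mod_cast this)
  · apply sum_eq_zero
    intro a _
    rw [if_neg]
    intro h'
    exact hd ((hq b).1 ⟨a, h'⟩)

open Finset in
theorem fd_tail (Y T : ℕ) (h : Y ≤ T) :
    ∑ d ∈ Ioc Y T, (1 / (d : ℝ) ^ 2) ≤ 1 / (Y + 1 / 2 : ℝ) - 1 / (T + 1 / 2 : ℝ) := by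
  induction T, h using Nat.le_induction with
  | base => simp
  | succ n hn ih =>
    rw [sum_Ioc_succ_top (by omega)]
    have hn0 : (0 : ℝ) ≤ n := by positivity
    have : 1 / ((n + 1 : ℕ) : ℝ) ^ 2
        ≤ 1 / (n + 1 / 2 : ℝ) - 1 / (((n + 1 : ℕ) : ℝ) + 1 / 2) := by
      push_cast
      rw [div_sub_div _ _ (by positivity) (by positivity),
        div_le_div_iff₀ (by positivity) (by positivity)]
      nlinarith
    linarith

open Finset in
theorem fd_quad (T : ℕ) (z : ℝ) (hz : 0 < z) (hzT : z ≤ T) (f : ℕ → ℝ)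
    (h1 : ∀ d ∈ Ioc 0 T, f d ≤ 1) (h2 : ∀ d ∈ Ioc 0 T, f d ≤ (z / d) ^ 2) :
    ∑ d ∈ Ioc 0 T, f d ≤ 3 * z := by
  have hY : ⌊z⌋₊ ≤ T := Nat.floor_le_of_le hzT
  have hYz : (⌊z⌋₊ : ℝ) ≤ z := Nat.floor_le hz.le
  have hzY : z < ⌊z⌋₊ + 1 := Nat.lt_floor_add_one z
  rw [← sum_Ioc_consecutive f (Nat.zero_le _) hY]
  have e1 : ∑ d ∈ Ioc 0 ⌊z⌋₊, f d ≤ ⌊z⌋₊ := by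
    calc _ ≤ ∑ d ∈ Ioc 0 ⌊z⌋₊, (1 : ℝ) := by
          apply sum_le_sum
          intro d hd
          apply h1
          rw [mem_Ioc] at hd ⊢
          omega
      _ = _ := by simp
  have e2 : ∑ d ∈ Ioc ⌊z⌋₊ T, f d ≤ z ^ 2 * ∑ d ∈ Ioc ⌊z⌋₊ T, (1 / (d : ℝ) ^ 2) := by
    rw [mul_sum]
    apply sum_le_sum
    intro d hd
    refine (h2 d ?_).trans (le_of_eq ?_)
    · rw [mem_Ioc] at hd ⊢
      omega
    · rw [div_pow]; ring
  have e3 := fd_tail ⌊z⌋₊ T hY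
  have e4 : (0 : ℝ) ≤ 1 / (T + 1 / 2 : ℝ) := by positivity
  have e5 : 1 / (⌊z⌋₊ + 1 / 2 : ℝ) ≤ 2 / z := by
    rw [div_le_div_iff₀ (by positivity) hz]
    linarith
  have e6 : z ^ 2 * ∑ d ∈ Ioc ⌊z⌋₊ T, (1 / (d : ℝ) ^ 2) ≤ z ^ 2 * (2 / z) := by
    gcongr
    linarith
  have e7 : z ^ 2 * (2 / z) = 2 * z := by field_simp
  linarith

open Finset in
theorem fd_sum_id (m : ℕ) : ∑ b ∈ Ioc 0 m, (b : ℝ) = m * (m + 1) / 2 := by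
  induction m with
  | zero => simp
  | succ n ih =>
    rw [sum_Ioc_succ_top (by omega), ih]
    push_cast
    ring

theorem fd_abs_mu (d : ℕ) : |(ArithmeticFunction.moebius d : ℝ)| ≤ 1 := by
  exact_mod_cast ArithmeticFunction.abs_moebius_le_one (n := d)

open Finset in
theorem fd_step (T : ℕ) (hT : 1 ≤ T) (x : ℝ) (hx : 0 < x) (hx1 : x < 1) :
    |fdE T x + fdE ⌊x * T⌋₊ x⁻¹| ≤ 4 * T := by
  obtain ⟨q, hq⟩ := fd_diag x hx
  set Y := ⌊x * T⌋₊ with hYdef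
  have hT0 : (1 : ℝ) ≤ T := by exact_mod_cast hT
  have hxT : x * T ≤ T := by nlinarith
  have hYT : Y ≤ T := Nat.floor_le_of_le hxT
  have hYx : (Y : ℝ) ≤ x * T := Nat.floor_le (by positivity)
  have hE2 : fdE Y x⁻¹ = ∑ d ∈ Ioc 0 T, (ArithmeticFunction.moebius d : ℝ) *
      ∑ b ∈ Ioc 0 (Y / d), ((⌊x⁻¹ * b⌋₊ : ℝ) - x⁻¹ * b) := by
    unfold fdE
    apply sum_subset (Ioc_subset_Ioc_right hYT)
    intro d hd hd'
    simp only [mem_Ioc] at hd hd'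
    have : Y / d = 0 := Nat.div_eq_of_lt (by omega)
    simp [this]
  -- bounds on the floors
  have hm1 : ∀ d ∈ Ioc 0 T, ((T / d : ℕ) : ℝ) ≤ (T : ℝ) / d := fun d _ => Nat.cast_div_le
  have hm2 : ∀ d ∈ Ioc 0 T, (T : ℝ) / d < (T / d : ℕ) + 1 := by
    intro d _
    rw [← Nat.floor_div_eq_div (K := ℝ)]
    exact Nat.lt_floor_add_one _
  have hn1 : ∀ d ∈ Ioc 0 T, ((Y / d : ℕ) : ℝ) ≤ x * (T / d) := by
    intro d _
    rw [hYdef, ← Nat.floor_div_natCast, mul_div_assoc]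
    exact Nat.floor_le (by positivity)
  have hn2 : ∀ d ∈ Ioc 0 T, x * (T / d) < (Y / d : ℕ) + 1 := by
    intro d _
    rw [hYdef, ← Nat.floor_div_natCast, mul_div_assoc]
    exact Nat.lt_floor_add_one _
  have key : ∀ d ∈ Ioc 0 T,
      ∑ b ∈ Ioc 0 (T / d), ((⌊x * b⌋₊ : ℝ) - x * b)
        + ∑ b ∈ Ioc 0 (Y / d), ((⌊x⁻¹ * b⌋₊ : ℝ) - x⁻¹ * b)
      = ((T / q / d : ℕ) : ℝ) - (((Y / d : ℕ) : ℝ) - x * (T / d : ℕ)) ^ 2 / (2 * x)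
        - x / 2 * (T / d : ℕ) - 1 / (2 * x) * (Y / d : ℕ) := by
    intro d hd
    have a1 : x * ((T / d : ℕ) : ℝ) < (Y / d : ℕ) + 1 :=
      lt_of_le_of_lt (mul_le_mul_of_nonneg_left (hm1 d hd) hx.le) (hn2 d hd)
    have a2 : ((Y / d : ℕ) : ℝ) < x * ((T / d : ℕ) + 1) :=
      lt_of_le_of_lt (hn1 d hd) (mul_lt_mul_of_pos_left (hm2 d hd) hx)
    have h := fd_recip x hx (T / d) (Y / d) a1 a2
    rw [hq _ _ a1, Nat.div_div_eq_div_mul, mul_comm d q, ← Nat.div_div_eq_div_mul] at h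
    rw [sum_sub_distrib, sum_sub_distrib, ← mul_sum, ← mul_sum, fd_sum_id, fd_sum_id]
    have h' : ∑ b ∈ Ioc 0 (T / d), (⌊x * b⌋₊ : ℝ) = ((T / d : ℕ) : ℝ) * (Y / d : ℕ)
      + ((T / q / d : ℕ) : ℝ) - ∑ a ∈ Ioc 0 (Y / d), (⌊x⁻¹ * a⌋₊ : ℝ) := by linarith
    rw [h']
    field_simp
    ring
  have hsum : fdE T x + fdE Y x⁻¹
      = ∑ d ∈ Ioc 0 T, (ArithmeticFunction.moebius d : ℝ) * ((T / q / d : ℕ) : ℝ)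
        - ∑ d ∈ Ioc 0 T, (ArithmeticFunction.moebius d : ℝ) *
          ((((Y / d : ℕ) : ℝ) - x * (T / d : ℕ)) ^ 2 / (2 * x))
        - x / 2 * ∑ d ∈ Ioc 0 T, (ArithmeticFunction.moebius d : ℝ) * ((T / d : ℕ) : ℝ)
        - 1 / (2 * x) * ∑ d ∈ Ioc 0 T, (ArithmeticFunction.moebius d : ℝ) * ((Y / d : ℕ) : ℝ) := by
    rw [hE2, fdE, ← sum_add_distrib, mul_sum, mul_sum, ← sum_sub_distrib, ← sum_sub_distrib,
      ← sum_sub_distrib]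
    apply sum_congr rfl
    intro d hd
    rw [← mul_add, key d hd]
    ring
  have hquad : |∑ d ∈ Ioc 0 T, (ArithmeticFunction.moebius d : ℝ) *
      ((((Y / d : ℕ) : ℝ) - x * (T / d : ℕ)) ^ 2 / (2 * x))| ≤ 3 / 2 * (T : ℝ) := by
    calc _ ≤ ∑ d ∈ Ioc 0 T, |(ArithmeticFunction.moebius d : ℝ) *
          ((((Y / d : ℕ) : ℝ) - x * (T / d : ℕ)) ^ 2 / (2 * x))| := abs_sum_le_sum_abs _ _
      _ ≤ ∑ d ∈ Ioc 0 T, (((Y / d : ℕ) : ℝ) - x * (T / d : ℕ)) ^ 2 / (2 * x) := by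
          apply sum_le_sum
          intro d _
          rw [abs_mul]
          have hp : 0 ≤ (((Y / d : ℕ) : ℝ) - x * (T / d : ℕ)) ^ 2 / (2 * x) := by positivity
          rw [abs_of_nonneg hp]
          exact mul_le_of_le_one_left hp (fd_abs_mu d)
      _ = (∑ d ∈ Ioc 0 T, (((Y / d : ℕ) : ℝ) - x * (T / d : ℕ)) ^ 2) / (2 * x) := by
          rw [sum_div]
      _ ≤ (3 * (x * T)) / (2 * x) := by
          gcongr
          apply fd_quad T (x * T) (by positivity) hxT
          · intro d hd
            have b1 := mul_le_mul_of_nonneg_left (hm1 d hd) hx.le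
            have b2 := mul_lt_mul_of_pos_left (hm2 d hd) hx
            have b3 := hn1 d hd
            have b4 := hn2 d hd
            rw [sq_le_one_iff_abs_le_one, abs_le]
            constructor <;> nlinarith
          · intro d hd
            have b1 := mul_le_mul_of_nonneg_left (hm1 d hd) hx.le
            have b3 := hn1 d hd
            have b5 : (0 : ℝ) ≤ (Y / d : ℕ) := by positivity
            have b6 : (0 : ℝ) ≤ x * (T / d : ℕ) := by positivity
            rw [mul_div_assoc]
            apply sq_le_sq'
            · linarith
            · linarith
      _ = 3 / 2 * T := by field_simp
  rw [fd_mu_floor T (T / q) (Nat.div_le_self _ _), fd_mu_floor T T le_rfl,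
    fd_mu_floor T Y hYT, if_pos hT] at hsum
  have c1 : (0 : ℝ) ≤ (if 1 ≤ T / q then (1 : ℝ) else 0) ∧
      (if 1 ≤ T / q then (1 : ℝ) else 0) ≤ 1 := by split_ifs <;> norm_num
  have c2 : (0 : ℝ) ≤ 1 / (2 * x) * (if 1 ≤ Y then (1 : ℝ) else 0) ∧
      1 / (2 * x) * (if 1 ≤ Y then (1 : ℝ) else 0) ≤ T / 2 := by
    split_ifs with h
    · have : (1 : ℝ) ≤ Y := by exact_mod_cast h
      refine ⟨by positivity, ?_⟩
      rw [mul_one, div_le_div_iff₀ (by positivity) (by positivity)]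
      nlinarith
    · rw [mul_zero]
      exact ⟨le_rfl, by positivity⟩
  rw [abs_le] at hquad
  rw [hsum, abs_le]
  constructor <;> linarith [c1.1, c1.2, c2.1, c2.2, hquad.1, hquad.2]

open Finset in
theorem fdE_fract (N : ℕ) (x : ℝ) (hx : 0 ≤ x) : fdE N x = fdE N (Int.fract x) := by
  unfold fdE
  apply sum_congr rfl
  intro d _
  congr 1
  apply sum_congr rfl
  intro b _
  have h1 : x * b = Int.fract x * b + ((⌊x⌋₊ * b : ℕ) : ℝ) := by
    have h2 : x = Int.fract x + (⌊x⌋₊ : ℝ) := by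
      rw [natCast_floor_eq_intCast_floor hx, Int.fract_add_floor]
    push_cast
    nth_rewrite 1 [h2]
    ring
  rw [h1, Nat.floor_add_natCast (mul_nonneg (Int.fract_nonneg x) (Nat.cast_nonneg b))]
  push_cast
  ring

theorem fdE_zero_left (x : ℝ) : fdE 0 x = 0 := by simp [fdE]

theorem fdE_zero_right (N : ℕ) : fdE N 0 = 0 := by simp [fdE]

theorem fd_step' (T : ℕ) (x : ℝ) (hx : 0 < x) (hx1 : x < 1) :
    |fdE T x| ≤ 4 * T + |fdE ⌊x * T⌋₊ (Int.fract x⁻¹)| := by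
  rcases Nat.eq_zero_or_pos T with rfl | hT
  · simp [fdE_zero_left]
  have h := fd_step T hT x hx hx1
  rw [fdE_fract _ x⁻¹ (by positivity)] at h
  rw [abs_le] at h
  have h1 := abs_le.1 (le_refl |fdE ⌊x * T⌋₊ (Int.fract x⁻¹)|)
  rw [abs_le]
  constructor <;> linarith [h.1, h.2, h1.1, h1.2]

theorem fd_main (T : ℕ) : ∀ x : ℝ, 0 ≤ x → x < 1 → |fdE T x| ≤ 16 * T := by
  induction T using Nat.strong_induction_on with
  | _ T ih =>
    intro x hx0 hx1
    rcases Nat.eq_zero_or_pos T with rfl | hT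
    · simp [fdE_zero_left]
    have hT0 : (1 : ℝ) ≤ T := by exact_mod_cast hT
    rcases hx0.eq_or_lt with rfl | hx
    · rw [fdE_zero_right]; simp
    have s1 := fd_step' T x hx hx1
    set y := Int.fract x⁻¹ with hy
    set Y := ⌊x * T⌋₊ with hY
    have hYx : (Y : ℝ) ≤ x * T := Nat.floor_le (by positivity)
    have hYT : (Y : ℝ) ≤ T := by nlinarith
    have hy0 : 0 ≤ y := Int.fract_nonneg _
    have hy1 : y < 1 := Int.fract_lt_one _
    rcases hy0.eq_or_lt with h0 | hy0'
    · rw [← h0, fdE_zero_right, abs_zero] at s1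
      linarith
    have s2 := fd_step' Y y hy0' hy1
    set Z := ⌊y * Y⌋₊ with hZ
    have hZy : (Z : ℝ) ≤ y * Y := Nat.floor_le (by positivity)
    have hxy : y * x ≤ 1 / 2 := by
      have e1 : (1 : ℝ) ≤ ⌊x⁻¹⌋ := by
        have : (1 : ℤ) ≤ ⌊x⁻¹⌋ := by
          rw [Int.le_floor]
          push_cast
          exact (one_lt_inv₀ hx).2 hx1 |>.le
        exact_mod_cast this
      have e2 : y = x⁻¹ - ⌊x⁻¹⌋ := rfl
      have e3 : x⁻¹ * x = 1 := inv_mul_cancel₀ hx.ne'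
      have e4 : y * x = 1 - ⌊x⁻¹⌋ * x := by rw [e2, sub_mul, e3]
      nlinarith
    have hZT : (Z : ℝ) ≤ T / 2 := by
      calc (Z : ℝ) ≤ y * Y := hZy
        _ ≤ y * (x * T) := by gcongr
        _ = (y * x) * T := by ring
        _ ≤ 1 / 2 * T := by gcongr
        _ = T / 2 := by ring
    have hZlt : Z < T := by
      have : (Z : ℝ) < T := by linarith
      exact_mod_cast this
    have s3 := ih Z hZlt (Int.fract y⁻¹) (Int.fract_nonneg _) (Int.fract_lt_one _)
    linarith

open Finset in
theorem fdP_one_ge (T : ℕ) (hT : 1 ≤ T) : (T : ℝ) ^ 2 / 6 ≤ fdP T 1 := by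
  have h1 : 2 * fdP T 1 - 1
      = ∑ d ∈ Ioc 0 T, (ArithmeticFunction.moebius d : ℝ) * ((T / d : ℕ) : ℝ) ^ 2 := by
    have h2 := fd_mu_floor T T le_rfl
    rw [if_pos hT] at h2
    have h3 : ∀ u : ℝ, 2 * u - 1 = 2 * u - ∑ d ∈ Ioc 0 T,
        (ArithmeticFunction.moebius d : ℝ) * ((T / d : ℕ) : ℝ) := fun u => by rw [h2]
    rw [h3, fdP_eq, mul_sum, ← sum_sub_distrib]
    apply sum_congr rfl
    intro d _
    simp only [one_mul, Nat.floor_natCast]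
    rw [fd_sum_id]
    ring
  rw [← sum_Ioc_consecutive _ (Nat.zero_le 1) hT] at h1
  have h3 : -((T : ℝ) ^ 2 * ∑ d ∈ Ioc 1 T, (1 / (d : ℝ) ^ 2))
      ≤ ∑ d ∈ Ioc 1 T, (ArithmeticFunction.moebius d : ℝ) * ((T / d : ℕ) : ℝ) ^ 2 := by
    rw [mul_sum, ← sum_neg_distrib]
    apply sum_le_sum
    intro d _
    have e1 : ((T / d : ℕ) : ℝ) ^ 2 ≤ (T : ℝ) ^ 2 * (1 / (d : ℝ) ^ 2) := by
      calc ((T / d : ℕ) : ℝ) ^ 2 ≤ ((T : ℝ) / d) ^ 2 := by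
            gcongr
            exact Nat.cast_div_le
        _ = _ := by rw [div_pow]; ring
    have e2 := (abs_le.1 (fd_abs_mu d)).1
    have e3 : (0 : ℝ) ≤ ((T / d : ℕ) : ℝ) ^ 2 := by positivity
    nlinarith
  have h4 := fd_tail 1 T hT
  have h5 : (0 : ℝ) ≤ 1 / (T + 1 / 2 : ℝ) := by positivity
  have h6 : ∑ d ∈ Ioc 1 T, (1 / (d : ℝ) ^ 2) ≤ 2 / 3 := by
    have h9 : 1 / (((1 : ℕ) : ℝ) + 1 / 2) = 2 / 3 := by norm_num
    linarith
  have h7 : (T : ℝ) ^ 2 * ∑ d ∈ Ioc 1 T, (1 / (d : ℝ) ^ 2) ≤ (T : ℝ) ^ 2 * (2 / 3) := by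
    gcongr
  have h8 : ∑ d ∈ Ioc 0 1, (ArithmeticFunction.moebius d : ℝ) * ((T / d : ℕ) : ℝ) ^ 2
      = (T : ℝ) ^ 2 := by
    simp
  rw [h8] at h1
  linarith

/-- pairs -/
theorem fd_inj (T : ℕ) : Set.InjOn (fun p : ℕ × ℕ => (p.1 : ℚ) / (p.2 : ℚ))
    (((Finset.range (T + 1)) ×ˢ (Finset.range (T + 1))).filter
    (fun p => p.1 < p.2 ∧ Nat.gcd p.1 p.2 = 1) : Finset (ℕ × ℕ)) := by
  rintro ⟨a, b⟩ h ⟨c, d⟩ h' heq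
  simp only [Finset.coe_filter, Set.mem_ofPred_eq] at h h'
  obtain ⟨_, h1, h2⟩ := h
  obtain ⟨_, h1', h2'⟩ := h'
  have hb : 0 < b := by omega
  have hd : 0 < d := by omega
  have e1 := Rat.div_int_inj (a := a) (b := b) (c := c) (d := d) (by exact_mod_cast hb)
    (by exact_mod_cast hd) (by simpa using h2) (by simpa using h2') (by simpa using heq)
  simpa using e1

open Finset in
theorem fd_count (T : ℕ) (x : ℝ) (D : DecidablePred fun q : ℚ => 0 ≤ (q : ℝ) ∧ (q : ℝ) ≤ x) :
    (((farey T).filter (fun q : ℚ => 0 ≤ (q : ℝ) ∧ (q : ℝ) ≤ x)).card : ℝ)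
      = ∑ b ∈ Ioc 0 T, ∑ a ∈ range b,
        if Nat.Coprime a b ∧ (a : ℝ) ≤ x * b then (1 : ℝ) else 0 := by
  classical
  unfold farey
  rw [filter_image, card_image_of_injOn
    ((fd_inj T).mono (by intro p hp; simp at hp ⊢; tauto))]
  rw [card_eq_sum_ones, filter_filter, sum_filter, sum_product_right]
  push_cast
  symm
  have hsub : Ioc 0 T ⊆ range (T + 1) := by
    intro b hb; simp at hb ⊢; omega
  rw [← sum_subset hsub]
  · apply sum_congr rfl
    intro b hb
    simp only [mem_Ioc] at hb
    have hsub2 : range b ⊆ range (T + 1) := by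
      intro a ha; simp at ha ⊢; omega
    rw [← sum_subset hsub2]
    · apply sum_congr rfl
      intro a ha
      have hab : a < b := by simpa using ha
      have hb0 : (0 : ℝ) < b := by exact_mod_cast hb.1
      have : (0 : ℝ) ≤ (a : ℝ) / b := by positivity
      simp only [hab, true_and, this, div_le_iff₀ hb0, Nat.Coprime]
    · intro a _ ha
      simp only [mem_range] at ha
      simp [ha]
  · intro b _ hb
    apply sum_eq_zero
    intro a _
    rw [if_neg]
    rintro ⟨⟨h1, _⟩, _⟩
    simp only [mem_Ioc, mem_range] at *
    omega

open Finset in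
theorem fd_F (T : ℕ) : (F T : ℝ) = fdP T 1 := by
  classical
  have h0 : (farey T).filter (fun q : ℚ => 0 ≤ (q : ℝ) ∧ (q : ℝ) ≤ 1) = farey T := by
    apply filter_true_of_mem
    intro q hq
    simp only [farey, mem_image, mem_filter] at hq
    obtain ⟨⟨a, b⟩, ⟨_, h, _⟩, rfl⟩ := hq
    have hb : (0 : ℝ) < b := by exact_mod_cast (by omega : 0 < b)
    have hab : (a : ℝ) ≤ b := by exact_mod_cast h.le
    push_cast
    exact ⟨by positivity, by rw [div_le_one hb]; exact hab⟩
  have h1 := fd_count T 1 (Classical.decPred _)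
  rw [F, ← h0]
  refine Eq.trans (by congr) (h1.trans ?_)
  unfold fdP
  apply sum_congr rfl
  intro b hb
  have hb0 := (mem_Ioc.1 hb).1
  simp only [one_mul, Nat.floor_natCast]
  have e1 : range b = insert 0 (Ioo 0 b) := by
    ext a; simp; omega
  have e2 : Ioc 0 b = insert b (Ioo 0 b) := by
    ext a; simp; omega
  rw [e1, e2, sum_insert (by simp), sum_insert (by simp)]
  congr 1
  · simp
  · apply sum_congr rfl
    intro a ha
    have : (a : ℝ) ≤ b := by exact_mod_cast (mem_Ioo.1 ha).2.le
    simp [this]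

open Finset in
theorem fd_count_lt (T : ℕ) (hT : 1 ≤ T) (x : ℝ) (hx : 0 ≤ x) (hx1 : x < 1) :
    ∑ b ∈ Ioc 0 T, ∑ a ∈ range b,
        (if Nat.Coprime a b ∧ (a : ℝ) ≤ x * b then (1 : ℝ) else 0) = fdP T x + 1 := by
  have h1 : (1 : ℝ) = ∑ b ∈ Ioc 0 T, if b = 1 then (1 : ℝ) else 0 := by
    rw [sum_ite_eq', if_pos (by simp; omega)]
  unfold fdP
  nth_rewrite 3 [h1]
  rw [← sum_add_distrib]
  apply sum_congr rfl
  intro b hb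
  have hb0 := (mem_Ioc.1 hb).1
  have hbr : (0 : ℝ) < b := by exact_mod_cast hb0
  have e1 : range b = insert 0 (Ioo 0 b) := by
    ext a; simp; omega
  rw [e1, sum_insert (by simp), add_comm]
  have hxb : 0 ≤ x * b := by positivity
  congr 1
  · rw [← sum_filter, ← sum_filter]
    congr 1
    ext a
    simp only [mem_filter, mem_Ioo, mem_Ioc, Nat.le_floor_iff hxb]
    constructor
    · rintro ⟨h1, h2, h3⟩; exact ⟨⟨h1.1, h3⟩, h2⟩
    · rintro ⟨⟨h1, h3⟩, h2⟩
      refine ⟨⟨h1, ?_⟩, h2, h3⟩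
      have : (a : ℝ) < b := by nlinarith
      exact_mod_cast this
  · simp [hxb]

open scoped Classical in
/-- Niederreiter's discrepancy bound: `|#(𝓕(T) ∩ [0,α]) - α·F(T)| ≤ K·F(T)/T`
uniformly in `0 ≤ α ≤ 1`. -/
theorem farey_discrepancy :
    ∃ K : ℝ, 0 < K ∧ ∀ T : ℕ, 1 ≤ T → ∀ α : ℝ, 0 ≤ α → α ≤ 1 →
      |(((farey T).filter (fun q => 0 ≤ (q : ℝ) ∧ (q : ℝ) ≤ α)).card : ℝ)
          - α * (F T : ℝ)|
        ≤ K * (F T : ℝ) / (T : ℝ) := by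
  refine ⟨102, by norm_num, ?_⟩
  intro T hT α h0 h1
  have hT0 : (1 : ℝ) ≤ T := by exact_mod_cast hT
  have hF := fdP_one_ge T hT
  have hK : 17 * (T : ℝ) ≤ 102 * (F T : ℝ) / T := by
    rw [le_div_iff₀ (by positivity), fd_F]
    nlinarith
  refine le_trans ?_ hK
  have hbr : (((farey T).filter (fun q => 0 ≤ (q : ℝ) ∧ (q : ℝ) ≤ α)).card : ℝ)
      = (((farey T).filter (fun q : ℚ => 0 ≤ (q : ℝ) ∧ (q : ℝ) ≤ α)).card : ℝ) := by
    have h2 := Finset.card_image_of_injective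
      ((farey T).filter (fun q : ℚ => 0 ≤ (q : ℝ) ∧ (q : ℝ) ≤ α))
      (f := fun q : ℚ => (q : ℝ)) Rat.cast_injective
    rw [← h2]
    congr 2
    ext y
    simp only [Finset.bind_def, Finset.pure_def, Finset.mem_filter, Finset.mem_sup,
      Finset.mem_singleton, Finset.mem_image]
    constructor
    · rintro ⟨⟨v, hv, rfl⟩, h⟩
      exact ⟨v, ⟨hv, h⟩, rfl⟩
    · rintro ⟨v, ⟨hv, h⟩, rfl⟩
      exact ⟨⟨v, hv, rfl⟩, h⟩
  rw [hbr, fd_count T α]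
  rcases h1.eq_or_lt with rfl | hlt
  · have h2 := fd_count T 1 (Classical.decPred _)
    have h3 : ((farey T).filter (fun q : ℚ => 0 ≤ (q : ℝ) ∧ (q : ℝ) ≤ 1)) = farey T := by
      apply Finset.filter_true_of_mem
      intro q hq
      simp only [farey, Finset.mem_image, Finset.mem_filter] at hq
      obtain ⟨⟨a, b⟩, ⟨_, h, _⟩, rfl⟩ := hq
      have hb : (0 : ℝ) < b := by exact_mod_cast (by omega : 0 < b)
      have hab : (a : ℝ) ≤ b := by exact_mod_cast h.le
      push_cast
      exact ⟨by positivity, by rw [div_le_one hb]; exact hab⟩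
    have h4 : (F T : ℝ) = (((farey T).filter
      (fun q : ℚ => 0 ≤ (q : ℝ) ∧ (q : ℝ) ≤ 1)).card : ℝ) := by rw [h3, F]
    rw [h4, fd_count T 1, one_mul, sub_self, abs_zero]
    positivity
  · rw [fd_count_lt T hT α h0 hlt, fd_F]
    have h2 := fdP_sub T α
    have h3 := abs_le.1 (fd_main T α h0 hlt)
    rw [abs_le]
    constructor <;> linarith [h3.1, h3.2]
end

section
/- There is a constant K > 0 such that for every integer T ≥ 1, |G(T) − (1/24)·F(T)| ≤ K·T. -/
open Finset in
lemma farey_inj {a b c d : ℕ} (hb : 0 < b) (hd : 0 < d) (h1 : Nat.gcd a b = 1)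
    (h2 : Nat.gcd c d = 1) (h : (a : ℚ) / b = (c : ℚ) / d) : a = c ∧ b = d := by
  have hb' : (b : ℚ) ≠ 0 := by positivity
  have hd' : (d : ℚ) ≠ 0 := by positivity
  rw [div_eq_div_iff hb' hd'] at h
  have h' : a * d = c * b := by exact_mod_cast h
  have e1 : b ∣ d := by
    have : b ∣ a * d := ⟨c, by rw [h']; ring⟩
    exact (Nat.Coprime.symm h1).dvd_of_dvd_mul_left this
  have e2 : d ∣ b := by
    have : d ∣ c * b := ⟨a, by rw [← h']; ring⟩
    exact (Nat.Coprime.symm h2).dvd_of_dvd_mul_left this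
  have e := Nat.dvd_antisymm e1 e2
  subst e
  exact ⟨Nat.eq_of_mul_eq_mul_right hb h', rfl⟩

/-- The centred test function. -/
noncomputable def fq (q : ℚ) : ℝ := (if q ≤ 1 / 2 then (q : ℝ) ^ 2 else 0) - 1 / 24

/-- Sum of the test function over reduced fractions of denominator `b`. -/
noncomputable def gq (b : ℕ) : ℝ :=
  ∑ a ∈ (Finset.range b).filter (fun a => Nat.gcd a b = 1), fq ((a : ℚ) / b)

lemma GF_eq (T : ℕ) : G T - (1 / 24) * (F T : ℝ) = ∑ b ∈ Finset.Icc 1 T, gq b := by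
  have h1 : G T - (1 / 24) * (F T : ℝ) = ∑ q ∈ farey T, fq q := by
    unfold G F fareyHalf fq
    rw [Finset.sum_sub_distrib, Finset.sum_filter]
    simp
    ring
  rw [h1]
  unfold farey
  rw [Finset.sum_image]
  · unfold gq
    rw [Finset.sum_sigma']
    refine Finset.sum_bij' (fun p _ => ⟨p.2, p.1⟩) (fun x _ => (x.2, x.1)) ?_ ?_ ?_ ?_ ?_
    · rintro ⟨a, b⟩ h
      simp at h ⊢
      refine ⟨⟨by omega, by omega⟩, h.2.1, h.2.2⟩
    · rintro ⟨b, a⟩ h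
      simp at h ⊢
      refine ⟨⟨by omega, by omega⟩, h.2.1, h.2.2⟩
    · intros; rfl
    · intros; rfl
    · intros; rfl
  · rintro ⟨a, b⟩ h ⟨c, d⟩ h' e
    simp at h h' e
    obtain ⟨r, s⟩ := farey_inj (by omega) (by omega) h.2.2 h'.2.2 e
    rw [r, s]

lemma sum_div_gq (n : ℕ) (hn : 0 < n) :
    ∑ d ∈ n.divisors, gq d = ∑ a ∈ Finset.range n, fq ((a : ℚ) / n) := by
  unfold gq
  rw [Finset.sum_sigma']
  have key : ∀ x : (_ : ℕ) × ℕ, x.1 ∣ n →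
      ((x.2 * (n / x.1) : ℕ) : ℚ) / n = (x.2 : ℚ) / x.1 := by
    rintro ⟨d, a⟩ ⟨k, rfl⟩
    have hd : 0 < d := Nat.pos_of_mul_pos_right hn
    have hk : 0 < k := Nat.pos_of_mul_pos_left hn
    simp only [Nat.mul_div_cancel_left k hd]
    have : (d : ℚ) ≠ 0 := by positivity
    have : (k : ℚ) ≠ 0 := by positivity
    push_cast
    field_simp
  refine Finset.sum_bij (fun x _ => x.2 * (n / x.1)) ?_ ?_ ?_ ?_
  · rintro ⟨d, a⟩ h
    simp at h ⊢
    obtain ⟨⟨⟨k, rfl⟩, -⟩, h2, h3⟩ := h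
    have hd : 0 < d := Nat.pos_of_mul_pos_right hn
    have hk : 0 < k := Nat.pos_of_mul_pos_left hn
    rw [Nat.mul_div_cancel_left k hd]
    exact Nat.mul_lt_mul_of_pos_right h2 hk
  · rintro ⟨d, a⟩ h ⟨d', a'⟩ h' e
    simp only [Finset.mem_sigma, Nat.mem_divisors, Finset.mem_filter, Finset.mem_range] at h h'
    have k1 := key ⟨d, a⟩ h.1.1
    have k2 := key ⟨d', a'⟩ h'.1.1
    simp only at e k1 k2
    rw [e, k2] at k1
    obtain ⟨r, s⟩ := farey_inj (by omega) (by omega) h'.2.2 h.2.2 k1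
    rw [r, s]
  · intro a ha
    simp at ha
    have hg : 0 < Nat.gcd a n := Nat.gcd_pos_of_pos_right _ hn
    refine ⟨⟨n / Nat.gcd a n, a / Nat.gcd a n⟩, ?_, ?_⟩
    · simp only [Finset.mem_sigma, Nat.mem_divisors, Finset.mem_filter, Finset.mem_range]
      refine ⟨⟨Nat.div_dvd_of_dvd (Nat.gcd_dvd_right a n), by omega⟩, ?_, ?_⟩
      · exact Nat.div_lt_div_of_lt_of_dvd (Nat.gcd_dvd_right a n) ha
      · exact Nat.gcd_div_gcd_div_gcd_of_pos_right hn
    · simp only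
      rw [Nat.div_div_self (Nat.gcd_dvd_right a n) (by omega)]
      exact Nat.div_mul_cancel (Nat.gcd_dvd_left a n)
  · intro x h
    simp only [Finset.mem_sigma, Nat.mem_divisors] at h
    rw [key x h.1.1]

lemma sum_sq (m : ℕ) : ∑ a ∈ Finset.range (m + 1), (a : ℝ) ^ 2 = m * (m + 1) * (2 * m + 1) / 6 := by
  induction m with
  | zero => simp
  | succ k ih => rw [Finset.sum_range_succ, ih]; push_cast; ring

lemma sum_fq (n : ℕ) (hn : 0 < n) :
    |∑ a ∈ Finset.range n, fq ((a : ℚ) / n) - (if 2 ∣ n then 1 / 8 else 0)| ≤ 1 / n := by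
  have h : ∑ a ∈ Finset.range n, fq ((a : ℚ) / n) =
      (((n / 2 : ℕ) : ℝ) * ((n / 2 : ℕ) + 1) * (2 * (n / 2 : ℕ) + 1) / 6) / n ^ 2 - n / 24 := by
    unfold fq
    rw [Finset.sum_sub_distrib, ← Finset.sum_filter, ← sum_sq, Finset.sum_div]
    congr 1
    · have : (Finset.range n).filter (fun a : ℕ => (a : ℚ) / n ≤ 1 / 2)
          = Finset.range (n / 2 + 1) := by
        ext a
        have hn' : (0 : ℚ) < n := by exact_mod_cast hn
        simp only [Finset.mem_filter, Finset.mem_range]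
        rw [div_le_div_iff₀ hn' two_pos]
        have : ((a : ℚ) * 2 ≤ 1 * n) ↔ a * 2 ≤ n := by
          rw [one_mul]; exact_mod_cast Iff.rfl
        rw [this]
        omega
      rw [this]
      refine Finset.sum_congr rfl fun a _ => ?_
      push_cast
      rw [div_pow]
    · simp; ring
  rw [h]
  have hn' : (0 : ℝ) < n := by exact_mod_cast hn
  rcases Nat.even_or_odd' n with ⟨k, rfl | rfl⟩
  · have hk : (k : ℝ) ≠ 0 := by
      have : k ≠ 0 := by omega
      exact_mod_cast this
    have hk' : (0 : ℝ) < k := by positivity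
    rw [if_pos (by simp), Nat.mul_div_cancel_left k two_pos]
    have : ((k : ℝ) * (k + 1) * (2 * k + 1) / 6) / ((2 * k : ℕ) : ℝ) ^ 2 - ((2 * k : ℕ) : ℝ) / 24 - 1 / 8
        = (1 / 12) * (1 / ((2 * k : ℕ) : ℝ)) := by
      push_cast; field_simp; ring
    rw [this, abs_of_nonneg (by positivity)]
    have : 0 < 1 / ((2 * k : ℕ) : ℝ) := by positivity
    linarith
  · rw [if_neg (by omega), show (2 * k + 1) / 2 = k by omega]
    have : ((k : ℝ) * (k + 1) * (2 * k + 1) / 6) / ((2 * k + 1 : ℕ) : ℝ) ^ 2 - ((2 * k + 1 : ℕ) : ℝ) / 24 - 0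
        = -((1 / 24) * (1 / ((2 * k + 1 : ℕ) : ℝ))) := by
      have : (2 * (k : ℝ) + 1) ≠ 0 := by positivity
      push_cast; field_simp; ring
    rw [this, abs_neg, abs_of_nonneg (by positivity)]
    have : 0 < 1 / ((2 * k + 1 : ℕ) : ℝ) := by positivity
    linarith

/-- `gq` with the contribution of denominator two removed. -/
noncomputable def hq (b : ℕ) : ℝ := gq b - (if b = 2 then 1 / 8 else 0)

lemma hq_bound (n : ℕ) (hn : 0 < n) : |hq n| ≤ ∑ d ∈ n.divisors, 1 / (d : ℝ) := by
  have h0 : ∀ n > 0, ∑ i ∈ n.divisors, hq i = (fun m => ∑ i ∈ m.divisors, hq i) n :=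
    fun _ _ => rfl
  have h1 := ArithmeticFunction.sum_eq_iff_sum_mul_moebius_eq.1 h0 n hn
  rw [← h1, ← Nat.sum_divisorsAntidiagonal' (fun _ d => 1 / (d : ℝ))]
  refine (Finset.abs_sum_le_sum_abs _ _).trans (Finset.sum_le_sum fun x hx => ?_)
  have hx2 : 0 < x.2 := by
    have := Nat.mem_divisorsAntidiagonal.1 hx
    rcases Nat.eq_zero_or_pos x.2 with h | h
    · rw [h] at this; omega
    · exact h
  rw [abs_mul]
  have a1 : |((ArithmeticFunction.moebius x.1 : ℤ) : ℝ)| ≤ 1 := by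
    have := ArithmeticFunction.abs_moebius_le_one (n := x.1)
    exact_mod_cast this
  have a2 : |∑ i ∈ x.2.divisors, hq i| ≤ 1 / (x.2 : ℝ) := by
    unfold hq
    rw [Finset.sum_sub_distrib, sum_div_gq _ hx2]
    have := sum_fq x.2 hx2
    convert this using 3
    rw [Finset.sum_ite_eq']
    simp [hx2.ne']
  calc _ ≤ 1 * (1 / (x.2 : ℝ)) := mul_le_mul a1 a2 (abs_nonneg _) zero_le_one
    _ = _ := one_mul _

lemma sum_inv_sq (T : ℕ) (hT : 1 ≤ T) : ∑ d ∈ Finset.Icc 1 T, 1 / (d : ℝ) ^ 2 ≤ 2 - 1 / (T : ℝ) := by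
  induction T, hT using Nat.le_induction with
  | base => norm_num
  | succ k hk ih =>
    rw [Finset.sum_Icc_succ_top (by omega)]
    have hk' : (0 : ℝ) < k := by exact_mod_cast hk
    have : 1 / ((k + 1 : ℕ) : ℝ) ^ 2 ≤ 1 / k - 1 / ((k + 1 : ℕ) : ℝ) := by
      push_cast
      rw [div_sub_div _ _ (by positivity) (by positivity), div_le_div_iff₀ (by positivity) (by positivity)]
      nlinarith
    linarith

lemma sum_sum_div (T : ℕ) (hT : 1 ≤ T) :
    ∑ n ∈ Finset.Icc 1 T, ∑ d ∈ n.divisors, 1 / (d : ℝ) ≤ 2 * T := by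
  have e : ∑ n ∈ Finset.Icc 1 T, ∑ d ∈ n.divisors, 1 / (d : ℝ)
      = ∑ d ∈ Finset.Icc 1 T, ∑ n ∈ (Finset.Ioc 0 T).filter (fun n => d ∣ n), 1 / (d : ℝ) := by
    refine Finset.sum_comm' fun n d => ?_
    simp only [Finset.mem_Icc, Nat.mem_divisors, Finset.mem_filter, Finset.mem_Ioc]
    constructor
    · rintro ⟨h1, h2, h3⟩
      have := Nat.le_of_dvd (by omega) h2
      have := Nat.pos_of_dvd_of_pos h2 (by omega)
      exact ⟨⟨⟨by omega, by omega⟩, h2⟩, by omega, by omega⟩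
    · rintro ⟨⟨h1, h2⟩, h3⟩
      exact ⟨by omega, h2, by omega⟩
  rw [e]
  have : ∀ d ∈ Finset.Icc 1 T, ∑ n ∈ (Finset.Ioc 0 T).filter (fun n => d ∣ n), 1 / (d : ℝ)
      ≤ T * (1 / (d : ℝ) ^ 2) := by
    intro d hd
    rw [Finset.sum_const, Nat.Ioc_filter_dvd_card_eq_div, nsmul_eq_mul]
    have : ((T / d : ℕ) : ℝ) ≤ T / d := Nat.cast_div_le
    calc _ ≤ (T / d : ℝ) * (1 / d) := by gcongr
      _ = _ := by ring
  refine (Finset.sum_le_sum this).trans ?_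
  rw [← Finset.mul_sum]
  have h := sum_inv_sq T hT
  have : (0 : ℝ) ≤ 1 / (T : ℝ) := by positivity
  have hT' : (0 : ℝ) ≤ T := by positivity
  nlinarith

/-- `G(T) = F(T)/24 + O(T)`. -/
theorem GT_eq_FT_div_24 :
    ∃ K : ℝ, 0 < K ∧ ∀ T : ℕ, 1 ≤ T →
      |G T - (1 / 24) * (F T : ℝ)| ≤ K * (T : ℝ) := by
  refine ⟨3, by norm_num, fun T hT => ?_⟩
  have e : ∑ b ∈ Finset.Icc 1 T, gq b
      = ∑ b ∈ Finset.Icc 1 T, hq b + ∑ b ∈ Finset.Icc 1 T, (if b = 2 then (1 / 8 : ℝ) else 0) := by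
    rw [← Finset.sum_add_distrib]
    exact Finset.sum_congr rfl fun b _ => by unfold hq; ring
  rw [GF_eq, e]
  have h1 : |∑ b ∈ Finset.Icc 1 T, hq b| ≤ 2 * T :=
    (Finset.abs_sum_le_sum_abs _ _).trans
      ((Finset.sum_le_sum fun b hb => hq_bound b (Finset.mem_Icc.1 hb).1).trans (sum_sum_div T hT))
  have h2 : |∑ b ∈ Finset.Icc 1 T, (if b = 2 then (1 / 8 : ℝ) else 0)| ≤ 1 := by
    rw [Finset.sum_ite_eq']
    split_ifs <;> norm_num
  have hT' : (1 : ℝ) ≤ T := by exact_mod_cast hT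
  have := abs_add_le (∑ b ∈ Finset.Icc 1 T, hq b)
    (∑ b ∈ Finset.Icc 1 T, (if b = 2 then (1 / 8 : ℝ) else 0))
  linarith
end

section
/- (Mertens, 1874.) There is a constant K > 0 such that for all integers T ≥ 2, |∑_{b=1}^{T} φ(b) − (3/π²)·T²| ≤ K·T·log T, where φ is Euler's totient function. Equivalently, F(T) = (3/π²)·T² + O(T log T). -/
open ArithmeticFunction in
lemma mertens_totient_sum_eq (T : ℕ) :
    ((∑ b ∈ Finset.Icc 1 T, Nat.totient b : ℕ) : ℝ) =
      ∑ d ∈ Finset.Ioc 0 T, (moebius d : ℝ) * (((T / d : ℕ) : ℝ) * (((T / d : ℕ) : ℝ) + 1) / 2) := by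
  let g : ArithmeticFunction ℝ := ⟨fun n => (n : ℝ), by simp⟩
  have h := sum_Ioc_mul_eq_sum_sum ((moebius : ArithmeticFunction ℤ) : ArithmeticFunction ℝ) g T
  have h1 : ∀ n > 0, ∑ x ∈ n.divisorsAntidiagonal, (moebius x.1 : ℝ) * (x.2 : ℝ)
      = (Nat.totient n : ℝ) := by
    refine (sum_eq_iff_sum_mul_moebius_eq (f := fun n => (Nat.totient n : ℝ))
      (g := fun n => (n : ℝ))).1 ?_
    intro n _
    exact_mod_cast Nat.sum_totient n
  have h2 : ∀ q : ℕ, ∑ m ∈ Finset.Ioc 0 q, g m = (q : ℝ) * ((q : ℝ) + 1) / 2 := by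
    intro q
    induction q with
    | zero => simp
    | succ q ih =>
      rw [Finset.sum_Ioc_succ_top (by omega), ih]
      show _ + ((q + 1 : ℕ) : ℝ) = _
      push_cast
      ring
  simp only [h2] at h
  have h3 : Finset.Icc 1 T = Finset.Ioc 0 T := by ext; simp; omega
  rw [h3]
  push_cast
  refine Eq.trans (Finset.sum_congr rfl fun n hn => ?_) (h.trans ?_)
  · rw [← h1 n (Finset.mem_Ioc.1 hn).1, mul_apply]
    rfl
  · rfl

open ArithmeticFunction in
lemma mertens_hasSum : HasSum (fun n : ℕ => (moebius n : ℝ) / (n : ℝ) ^ 2) (6 / Real.pi ^ 2) := by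
  have hs : 1 < (2 : ℂ).re := by norm_num
  have h1 := LSeries_zeta_mul_Lseries_moebius hs
  rw [LSeries_zeta_eq_riemannZeta hs, riemannZeta_two] at h1
  have h2 := (LSeriesSummable_moebius_iff.mpr hs).LSeriesHasSum
  have hpi : (Real.pi : ℂ) ≠ 0 := by exact_mod_cast Real.pi_ne_zero
  have h3 : LSeries (fun n => (moebius n : ℂ)) 2 = ((6 / Real.pi ^ 2 : ℝ) : ℂ) := by
    push_cast
    field_simp
    field_simp at h1
    linear_combination h1
  rw [h3, LSeriesHasSum] at h2
  rw [← Complex.hasSum_ofReal]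
  convert! h2 using 1
  ext n
  rcases eq_or_ne n 0 with rfl | hn
  · simp
  · simp [LSeries.term_of_ne_zero hn]

lemma mertens_abs_moebius (n : ℕ) : |(ArithmeticFunction.moebius n : ℝ)| ≤ 1 := by
  exact_mod_cast ArithmeticFunction.abs_moebius_le_one (n := n)

open ArithmeticFunction in
lemma mertens_tail (T : ℕ) (hT : 2 ≤ T) :
    |∑ d ∈ Finset.Ioc 0 T, (moebius d : ℝ) / (d : ℝ) ^ 2 - 6 / Real.pi ^ 2| ≤ (1 : ℝ) / (T : ℝ) := by
  have h := mertens_hasSum.tendsto_sum_nat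
  have h' := (((h.comp (Filter.tendsto_add_atTop_nat 1)).const_sub
    (∑ d ∈ Finset.Ioc 0 T, (moebius d : ℝ) / (d : ℝ) ^ 2))).abs
  refine le_of_tendsto h' ?_
  filter_upwards [Filter.eventually_ge_atTop T] with N hN
  have e1 : ∑ i ∈ Finset.range (N + 1), (moebius i : ℝ) / (i : ℝ) ^ 2
      = ∑ i ∈ Finset.Ioc 0 N, (moebius i : ℝ) / (i : ℝ) ^ 2 := by
    symm
    apply Finset.sum_subset
    · intro x; simp
    · intro x hx hx'
      have : x = 0 := by simp at hx hx'; omega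
      simp [this]
  have e2 := Finset.sum_Ioc_consecutive (fun i : ℕ => (moebius i : ℝ) / (i : ℝ) ^ 2)
    (Nat.zero_le T) hN
  simp only [Function.comp]
  rw [e1, ← e2, sub_add_cancel_left, abs_neg]
  refine (Finset.abs_sum_le_sum_abs _ _).trans ?_
  have h3 : ∑ i ∈ Finset.Ioc T N, |(moebius i : ℝ) / (i : ℝ) ^ 2|
      ≤ ∑ i ∈ Finset.Ioc T N, ((i : ℝ) ^ 2)⁻¹ := by
    refine Finset.sum_le_sum fun i _ => ?_
    rw [abs_div, abs_of_nonneg (by positivity : (0 : ℝ) ≤ (i : ℝ) ^ 2), div_eq_mul_inv]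
    exact mul_le_of_le_one_left (by positivity) (mertens_abs_moebius i)
  have h4 := sum_Ioc_inv_sq_le_sub (α := ℝ) (by omega : T ≠ 0) hN
  have h5 : (0 : ℝ) ≤ (N : ℝ)⁻¹ := by positivity
  rw [one_div]
  linarith

lemma mertens_floor (T d : ℕ) (hd : 0 < d) :
    |((T / d : ℕ) : ℝ) * (((T / d : ℕ) : ℝ) + 1) / 2 - ((T : ℝ) / d) ^ 2 / 2|
      ≤ (T : ℝ) / d / 2 := by
  have hd' : (0 : ℝ) < d := by exact_mod_cast hd
  have h1 : ((T / d : ℕ) : ℝ) ≤ (T : ℝ) / d := Nat.cast_div_le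
  have h2 : (T : ℝ) / d ≤ ((T / d : ℕ) : ℝ) + 1 := by
    rw [div_le_iff₀ hd']
    have := Nat.lt_mul_div_succ T hd
    have h : (T : ℝ) ≤ d * ((T / d : ℕ) + 1) := by exact_mod_cast this.le
    linarith
  have h3 : (0 : ℝ) ≤ ((T / d : ℕ) : ℝ) := by positivity
  generalize ((T / d : ℕ) : ℝ) = q at *
  generalize (T : ℝ) / d = x at *
  rw [abs_le]
  constructor <;> nlinarith

open ArithmeticFunction in
/-- Mertens (1874): `∑_{b ≤ T} φ(b) = (3/π²)·T² + O(T·log T)`. -/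
theorem totient_sum_asymptotic :
    ∃ K : ℝ, 0 < K ∧ ∀ T : ℕ, 2 ≤ T →
      |((∑ b ∈ Finset.Icc 1 T, Nat.totient b : ℕ) : ℝ)
          - 3 / Real.pi ^ 2 * (T : ℝ) ^ 2|
        ≤ K * (T : ℝ) * Real.log T := by
  refine ⟨3, by norm_num, fun T hT => ?_⟩
  have hT0 : (2 : ℝ) ≤ T := by exact_mod_cast hT
  have hlog : 1 / 2 ≤ Real.log T := by
    have := Real.log_le_log (by norm_num) hT0
    have := Real.log_two_gt_d9
    linarith
  rw [mertens_totient_sum_eq]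
  have key : ∑ d ∈ Finset.Ioc 0 T, (moebius d : ℝ) *
        (((T / d : ℕ) : ℝ) * (((T / d : ℕ) : ℝ) + 1) / 2) - 3 / Real.pi ^ 2 * (T : ℝ) ^ 2
      = ∑ d ∈ Finset.Ioc 0 T, (moebius d : ℝ) *
        (((T / d : ℕ) : ℝ) * (((T / d : ℕ) : ℝ) + 1) / 2 - ((T : ℝ) / d) ^ 2 / 2)
        + (T : ℝ) ^ 2 / 2 *
          (∑ d ∈ Finset.Ioc 0 T, (moebius d : ℝ) / (d : ℝ) ^ 2 - 6 / Real.pi ^ 2) := by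
    rw [mul_sub, Finset.mul_sum, ← add_sub_assoc, ← Finset.sum_add_distrib]
    congr 1
    · refine Finset.sum_congr rfl fun d _ => ?_
      ring
    · ring
  rw [key]
  have b1 : |∑ d ∈ Finset.Ioc 0 T, (moebius d : ℝ) *
        (((T / d : ℕ) : ℝ) * (((T / d : ℕ) : ℝ) + 1) / 2 - ((T : ℝ) / d) ^ 2 / 2)|
      ≤ (T : ℝ) / 2 * (1 + Real.log T) := by
    refine (Finset.abs_sum_le_sum_abs _ _).trans ?_
    have hh := harmonic_le_one_add_log T
    rw [harmonic_eq_sum_Icc] at hh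
    push_cast at hh
    have h3 : Finset.Icc 1 T = Finset.Ioc 0 T := by ext; simp; omega
    rw [h3] at hh
    refine le_trans ?_ (mul_le_mul_of_nonneg_left hh (by positivity))
    rw [Finset.mul_sum]
    refine Finset.sum_le_sum fun d hd => ?_
    rw [abs_mul]
    refine (mul_le_of_le_one_left (abs_nonneg _) (mertens_abs_moebius d)).trans ?_
    refine (mertens_floor T d (Finset.mem_Ioc.1 hd).1).trans (le_of_eq ?_)
    ring
  have b2 : |(T : ℝ) ^ 2 / 2 *
      (∑ d ∈ Finset.Ioc 0 T, (moebius d : ℝ) / (d : ℝ) ^ 2 - 6 / Real.pi ^ 2)| ≤ (T : ℝ) / 2 := by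
    rw [abs_mul, abs_of_nonneg (by positivity : (0 : ℝ) ≤ (T : ℝ) ^ 2 / 2)]
    refine (mul_le_mul_of_nonneg_left (mertens_tail T hT) (by positivity)).trans (le_of_eq ?_)
    field_simp
  refine (abs_add_le _ _).trans ((add_le_add b1 b2).trans ?_)
  nlinarith
end
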